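/- (Adaptive LISO mean squared error.) Let $d,q\ge 1$. Let $f:\mathbb R^d\to\mathbb R$ be four times continuously differentiable with a unique global minimizer $x^\star$ that is well separated, i.e. $\inf_{\|x-x^\star\|\ge r} f(x)>f(x^\star)$ for every $r>0$, with positive-definite Hessian $H:=H_f(x^\star)$ and with $\int_{\mathbb R^d} e^{-f(x)}\,dx<\infty$. For a twice continuously differentiable $\psi=(\psi_1,\dots,\psi_p):\mathbb R^d\to\mathbb R^p$ put $$C_{f,\psi}:=\sum_{i=1}^p\Bigl|\mathrm{Tr}\bigl(H^{-1}H_{\psi_i}(x^\star)\bigr)-\bigl\langle\nabla\psi_i(x^\star),\,H^{-1}\,\mathrm{PTr}(D^3f(x^\star))\bigr\rangle\Bigr|,\qquad \mathrm{PTr}(D^3f(x^\star))_j:=\sum_{k,l=1}^d (H^{-1})_{kl}\,\partial_j\partial_k\partial_l f(x^\star),$$ and for $\alpha>0$ let $m_\alpha:=\sqrt{\det H}\,(\alpha/(2\pi))^{d/2}$. Let $\varphi:\mathbb R^d\to\mathbb R^q$ be twice continuously differentiable with $C_{f,\varphi}>0$ and $\int e^{-f}\|\varphi\|<\infty$, and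 put $\bar\varphi:=\varphi-\varphi(x^\star)$. Let $g_0:\mathbb R^d\to(0,\infty)$ be such that: $e^{-(f(y)-f(x^\star))}\le c_0\,g_0(y)$ for all $y$, for some $c_0>0$; $\int e^{-(f(y)-f(x^\star))}\|\varphi(y)\|^2\,dy<\infty$; the functions $\|\varphi\|^2/g_0$, $\|\bar\varphi\|^2/g_0$, $1/g_0$ are twice continuously differentiable; and $C_{f,\|\varphi\|^2/g_0}$, $C_{f,\|\bar\varphi\|^2/g_0}$, $C_{f,1/g_0}$ are positive. Let $\mathcal Q$ be a family of probability densities on $\mathbb R^d$ with $g_0\le p$ pointwise for all $p\in\mathcal Q$ and $\sup_{p\in\mathcal Q}\int\|\varphi\|^4p\le M<\infty$. Let $(\mathcal F_i)_{i\ge0}$ be a filtration on a probability space and $(X^i)_{i\ge1}$ random vectors in $\mathbb R^d$ with $X^i$ being $\mathcal F_i$-measurable, such that $X^1$ has a density $q_0\in\mathcal Q$ and, for every $i\ge1$, the conditional distribution of $X^{i+1}$ given $\mathcal F_i$ has an $\mathcal F_i$-measurable random density $q_i$ that belongs almost surely to $\mathcal Q$. Put $$w^i:=\frac{e^{-\alpha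 f(X^i)}}{q_{i-1}(X^i)},\qquad \pi^{(A)}_{n,\alpha}(\varphi):=\frac{\sum_{i=1}^n w^i\varphi(X^i)}{\sum_{i=1}^n w^i}.$$ Then there are a constant $\tilde\alpha>1$ depending only on $f$ and $\varphi$, a constant $c>0$ depending only on $f,g_0,\varphi$, and a constant $C>0$ depending only on $f,g_0,\varphi$ and $M$, such that for every $\alpha>\tilde\alpha$ and every integer $n\ge1$ with $$n\ge c\,\alpha^{d/2}\log\bigl(n\,\alpha^{-d/2+1}(\sqrt n+\alpha^{d/4})\,\alpha\bigr),$$ one has $$\mathbb E\bigl\|\pi^{(A)}_{n,\alpha}(\varphi)-\varphi(x^\star)\bigr\|^2\le 9\,n^{-1}m_\alpha\,2^{-d/2}\,\frac{C_{f,\|\bar\varphi\|^2/g_0}}{2\alpha}\Bigl(1+\frac C\alpha\Bigr)+\frac{(C_{f,\varphi})^2}{\alpha^2}.$$ -/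

import Mathlib

open MeasureTheory

namespace LISO

noncomputable section

/-- `ℝ^d` with the Euclidean norm. -/
abbrev E (d : ℕ) := EuclideanSpace ℝ (Fin d)

/-- The `i`-th standard basis vector of `ℝ^d`. -/
def bvec (d : ℕ) (i : Fin d) : E d := EuclideanSpace.single i 1

/-- The gradient `(∂_i ψ(x))_i`. -/
def grad {d : ℕ} (ψ : E d → ℝ) (x : E d) : Fin d → ℝ :=
  fun i => fderiv ℝ ψ x (bvec d i)

/-- The Hessian matrix `(∂_i ∂_j ψ(x))_{i,j}`. -/
def hess {d : ℕ} (ψ : E d → ℝ) (x : E d) : Matrix (Fin d) (Fin d) ℝ :=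
  Matrix.of fun i j => iteratedFDeriv ℝ 2 ψ x ![bvec d i, bvec d j]

/-- The partial trace of `D³f(x)` in the metric given by `H = H_f(x)`, i.e. the vector with
`i`-th entry `∑_{k,l} (H⁻¹)_{kl} ∂_i ∂_k ∂_l f(x)`; for `H = I` this is `∑_k ∂_i ∂_k ∂_k f(x)`. -/
def ptr3 {d : ℕ} (f : E d → ℝ) (x : E d) : Fin d → ℝ :=
  fun i => ∑ k, ∑ l, (hess f x)⁻¹ k l *
    iteratedFDeriv ℝ 3 f x ![bvec d i, bvec d k, bvec d l]

/-- The Laplace coefficient `Tr(H⁻¹ H_ψ(x)) - ⟨∇ψ(x), H⁻¹ PTr(D³f(x))⟩`, with `H = H_f(x)`. -/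
def laplaceCoeff {d : ℕ} (f : E d → ℝ) (x : E d) (ψ : E d → ℝ) : ℝ :=
  ((hess f x)⁻¹ * hess ψ x).trace -
    dotProduct (grad ψ x) (((hess f x)⁻¹).mulVec (ptr3 f x))

/-- `C_{f,ψ}` for a scalar `ψ`. -/
def CLs {d : ℕ} (f : E d → ℝ) (x : E d) (ψ : E d → ℝ) : ℝ :=
  |laplaceCoeff f x ψ|

/-- `C_{f,φ}` for `φ : ℝ^d → ℝ^q`. -/
def CL {d q : ℕ} (f : E d → ℝ) (x : E d) (φ : E d → E q) : ℝ :=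
  ∑ i : Fin q, CLs f x (fun y => φ y i)

/-- `m_α = √(det H_f(x⋆)) (α/(2π))^{d/2}`. -/
def mconst {d : ℕ} (f : E d → ℝ) (xs : E d) (α : ℝ) : ℝ :=
  Real.sqrt (hess f xs).det * (α / (2 * Real.pi)) ^ ((d : ℝ) / 2)

/-- The assumptions on the objective `f` and its minimizer `x⋆`. -/
structure Objective {d : ℕ} (f : E d → ℝ) (xs : E d) : Prop where
  smooth : ContDiff ℝ 4 f
  unique_min : ∀ x, x ≠ xs → f xs < f x
  /-- `f` does not come back to its minimum value at infinity. -/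
  separated : ∀ r > 0, ∃ η > 0, ∀ x, r ≤ ‖x - xs‖ → f xs + η ≤ f x
  hess_pos : (hess f xs).PosDef
  integrable : Integrable fun x => Real.exp (-f x)

/-- The assumptions on the test function `φ`. -/
structure TestFunction {d q : ℕ} (f : E d → ℝ) (xs : E d) (φ : E d → E q) : Prop where
  smooth : ContDiff ℝ 2 φ
  coeff_pos : 0 < CL f xs φ
  integrable : Integrable fun x => Real.exp (-f x) * ‖φ x‖

/-- The assumptions that link the lower envelope `g₀` with `f` and `φ`. -/
structure Envelope {d q : ℕ} (f : E d → ℝ) (xs : E d) (φ : E d → E q) (g₀ : E d → ℝ) :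
    Prop where
  pos : ∀ x, 0 < g₀ x
  tail : ∃ c₀ > 0, ∀ y, Real.exp (-(f y - f xs)) ≤ c₀ * g₀ y
  integrable_sq : Integrable fun y => Real.exp (-(f y - f xs)) * ‖φ y‖ ^ 2
  smooth_sq : ContDiff ℝ 2 fun x => ‖φ x‖ ^ 2 / g₀ x
  smooth_bar_sq : ContDiff ℝ 2 fun x => ‖φ x - φ xs‖ ^ 2 / g₀ x
  smooth_inv : ContDiff ℝ 2 fun x => 1 / g₀ x
  coeff_sq_pos : 0 < CLs f xs fun x => ‖φ x‖ ^ 2 / g₀ x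
  coeff_bar_sq_pos : 0 < CLs f xs fun x => ‖φ x - φ xs‖ ^ 2 / g₀ x
  coeff_inv_pos : 0 < CLs f xs fun x => 1 / g₀ x

/-- `p` is a probability density on `ℝ^d`. -/
structure IsDensity {d : ℕ} (p : E d → ℝ) : Prop where
  measurable : Measurable p
  nonneg : ∀ x, 0 ≤ p x
  integrable : Integrable p
  integral_eq_one : ∫ x, p x = 1

/-- `𝒬` is a family of probability densities above `g₀`, with `sup_{p ∈ 𝒬} ∫ ‖φ‖⁴ p ≤ M`. -/
structure PolicyFamily {d q : ℕ} (φ : E d → E q) (g₀ : E d → ℝ) (M : ℝ)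
    (𝒬 : Set (E d → ℝ)) : Prop where
  density : ∀ p ∈ 𝒬, IsDensity p
  lower : ∀ p ∈ 𝒬, ∀ x, g₀ x ≤ p x
  moment_integrable : ∀ p ∈ 𝒬, Integrable fun y => ‖φ y‖ ^ 4 * p y
  moment_le : ∀ p ∈ 𝒬, ∫ y, ‖φ y‖ ^ 4 * p y ≤ M

/-- Adaptive sampling: `X 1` has the deterministic density `p 0 = q₀ ∈ 𝒬`; for `i ≥ 1` the
conditional law of `X (i + 1)` given `F i` has the `F i`-measurable random density `p i`, which
is almost surely in `𝒬`; and `X i` is `F i`-measurable for `i ≥ 1` (`X 0` plays no role). -/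
structure AdaptiveSampling {d : ℕ} {Ω : Type*} {mΩ : MeasurableSpace Ω} (P : Measure Ω)
    (F : Filtration ℕ mΩ) (𝒬 : Set (E d → ℝ)) (X : ℕ → Ω → E d) (p : ℕ → Ω → E d → ℝ) :
    Prop where
  adapted : ∀ i, Measurable[F (i + 1)] (X (i + 1))
  init : ∃ q₀ ∈ 𝒬, (∀ ω, p 0 ω = q₀) ∧
    P.map (X 1) = volume.withDensity (fun x => ENNReal.ofReal (q₀ x))
  measurable_density : ∀ i, 1 ≤ i →
    Measurable[(F i).prod inferInstance] (Function.uncurry (p i))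
  mem : ∀ i, 1 ≤ i → ∀ᵐ ω ∂P, p i ω ∈ 𝒬
  cond_law : ∀ i, 1 ≤ i → ∀ s : Set (E d), MeasurableSet s →
    P[(X (i + 1) ⁻¹' s).indicator (fun _ => (1 : ℝ)) | F i] =ᵐ[P]
      fun ω => ∫ x in s, p i ω x

/-- The weight `w^{i+1} = exp(-α f(X^{i+1})) / q_i(X^{i+1})`. -/
def weight {d : ℕ} {Ω : Type*} (f : E d → ℝ) (α : ℝ) (X : ℕ → Ω → E d)
    (p : ℕ → Ω → E d → ℝ) (i : ℕ) (ω : Ω) : ℝ :=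
  Real.exp (-α * f (X (i + 1) ω)) / p i ω (X (i + 1) ω)

/-- The self-normalized estimator `(∑_{i=1}^n w^i φ(X^i)) / ∑_{i=1}^n w^i`. -/
def estimator {d q : ℕ} {Ω : Type*} (f : E d → ℝ) (φ : E d → E q) (α : ℝ)
    (X : ℕ → Ω → E d) (p : ℕ → Ω → E d → ℝ) (n : ℕ) (ω : Ω) : E q :=
  (∑ i ∈ Finset.range n, weight f α X p i ω)⁻¹ •
    ∑ i ∈ Finset.range n, weight f α X p i ω • φ (X (i + 1) ω)

end

end LISO

namespace LISO

open Filter Topology Asymptotics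

/-- Second-order Taylor expansion at a critical zero. -/
theorem taylor_two_isLittleO {V : Type*} [NormedAddCommGroup V] [NormedSpace ℝ V] {ρ : V → ℝ}
    {x : V} (h : ContDiffAt ℝ 2 ρ x) (h0 : ρ x = 0) (h1 : fderiv ℝ ρ x = 0) :
    (fun y => ρ (x + y) - fderiv ℝ (fderiv ℝ ρ) x y y / 2) =o[𝓝 0] fun y : V => ‖y‖ ^ 2 := by
  set B := fderiv ℝ (fderiv ℝ ρ) x with hB
  have hsymm : ∀ u v, B u v = B v u := fun u v =>
    (h.isSymmSndFDerivAt (by simp)) u v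
  have hd : ∀ᶠ y in 𝓝 (0 : V), DifferentiableAt ℝ ρ (x + y) := by
    have h' : ∀ᶠ z in 𝓝 x, DifferentiableAt ℝ ρ z := by
      filter_upwards [h.eventually (by simp)] with z hz
      exact hz.differentiableAt (by simp)
    have ht : Tendsto (fun y : V => x + y) (𝓝 0) (𝓝 x) := by
      have : Tendsto (fun y : V => x + y) (𝓝 0) (𝓝 (x + 0)) :=
        (continuous_const.add continuous_id).tendsto 0
      simpa using this
    exact ht.eventually h'
  have hB' : HasFDerivAt (fderiv ℝ ρ) B x := by
    have : ContDiffAt ℝ 1 (fderiv ℝ ρ) x := h.fderiv_right (m := 1) (by norm_num)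
    exact (this.differentiableAt (by simp)).hasFDerivAt
  rw [isLittleO_iff]
  intro ε hε
  have h2 : ∀ᶠ y in 𝓝 (0 : V), ‖fderiv ℝ ρ (x + y) - B y‖ ≤ ε * ‖y‖ := by
    have h3 := (hasFDerivAt_iff_isLittleO_nhds_zero.1 hB').def hε
    filter_upwards [h3] with y hy
    simpa [h1] using hy
  obtain ⟨r, hr, hball⟩ := Metric.eventually_nhds_iff_ball.1 (hd.and h2)
  filter_upwards [Metric.ball_mem_nhds (0 : V) hr] with y hy
  have hder : ∀ z ∈ Metric.closedBall (0 : V) ‖y‖,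
      HasFDerivAt (fun y => ρ (x + y) - B y y / 2) (fderiv ℝ ρ (x + z) - B z) z := by
    intro z hz
    have hzr : z ∈ Metric.ball (0 : V) r := by
      simp only [Metric.mem_closedBall, Metric.mem_ball, dist_zero_right] at *
      linarith
    have ha : HasFDerivAt (fun y => ρ (x + y)) (fderiv ℝ ρ (x + z)) z := by
      have := (hball z hzr).1.hasFDerivAt
      exact this.comp z ((hasFDerivAt_id z).const_add x)
    have hb : HasFDerivAt (fun y => B y y / 2) (B z) z := by
      have hb1 := (B.hasFDerivAt (x := z)).clm_apply (hasFDerivAt_id z)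
      have hb2 := hb1.mul_const (2⁻¹ : ℝ)
      simp only [id] at hb2
      refine hb2.congr_fderiv ?_
      ext v
      simp [hsymm v z]
      ring
    exact ha.sub hb
  have := (convex_closedBall (0 : V) ‖y‖).norm_image_sub_le_of_norm_hasFDerivWithin_le
    (f := fun y => ρ (x + y) - B y y / 2) (C := ε * ‖y‖) (x := 0) (y := y)
    (fun z hz => (hder z hz).hasFDerivWithinAt) (fun z hz => by
      have hzr : z ∈ Metric.ball (0 : V) r := by
        simp only [Metric.mem_closedBall, Metric.mem_ball, dist_zero_right] at *
        linarith
      refine (hball z hzr).2.trans ?_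
      have : ‖z‖ ≤ ‖y‖ := by simpa using hz
      gcongr) (by simp) (by simp)
  simpa [h0, sq, mul_assoc] using this

theorem integrable_exp_neg_mul_sq_norm {d : ℕ} {b : ℝ} (hb : 0 < b) :
    Integrable fun v : E d => Real.exp (-b * ‖v‖ ^ 2) := by
  have := GaussianFourier.integrable_cexp_neg_mul_sq_norm_add (V := E d) (b := (b : ℂ))
    (by simpa using hb) 0 0
  refine this.re.congr (ae_of_all _ fun v => ?_)
  simp only [zero_mul, add_zero]
  rw [show (-(b : ℂ) * (‖v‖ : ℂ) ^ 2) = ((-b * ‖v‖ ^ 2 : ℝ) : ℂ) by push_cast; ring,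
    ← Complex.ofReal_exp]
  exact Complex.ofReal_re _

theorem integrable_pow_norm_mul_exp_neg {d : ℕ} (k : ℕ) {b : ℝ} (hb : 0 < b) :
    Integrable fun v : E d => ‖v‖ ^ k * Real.exp (-b * ‖v‖ ^ 2) := by
  have hb2 : 0 < b / 2 := by positivity
  have hi := (integrable_exp_neg_mul_sq_norm (d := d) hb2).const_mul
    (1 + (k.factorial : ℝ) / (b / 2) ^ k)
  refine hi.mono' (by fun_prop) (ae_of_all _ fun v => ?_)
  rw [Real.norm_of_nonneg (by positivity)]
  have h1 : ‖v‖ ^ k ≤ 1 + (‖v‖ ^ 2) ^ k := by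
    rcases le_total ‖v‖ 1 with h | h
    · have : ‖v‖ ^ k ≤ 1 := pow_le_one₀ (norm_nonneg _) h
      have : 0 ≤ (‖v‖ ^ 2) ^ k := by positivity
      linarith
    · have : ‖v‖ ^ k ≤ (‖v‖ ^ 2) ^ k := by gcongr; nlinarith
      linarith
  have h2 := Real.pow_div_factorial_le_exp (b / 2 * ‖v‖ ^ 2) (by positivity) k
  rw [mul_pow, div_le_iff₀ (by positivity)] at h2
  have h3 : (‖v‖ ^ 2) ^ k ≤ (k.factorial : ℝ) / (b / 2) ^ k * Real.exp (b / 2 * ‖v‖ ^ 2) := by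
    rw [div_mul_eq_mul_div, le_div_iff₀ (by positivity)]
    linarith
  have h4 : (1 : ℝ) ≤ Real.exp (b / 2 * ‖v‖ ^ 2) := Real.one_le_exp (by positivity)
  have h5 : Real.exp (-(b / 2) * ‖v‖ ^ 2)
      = Real.exp (b / 2 * ‖v‖ ^ 2) * Real.exp (-b * ‖v‖ ^ 2) := by
    rw [← Real.exp_add]; congr 1; ring
  rw [h5, ← mul_assoc]
  gcongr
  calc ‖v‖ ^ k ≤ 1 + (‖v‖ ^ 2) ^ k := h1
    _ ≤ _ := by rw [add_mul, one_mul]; linarith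

/-- The quadratic form `uᵀ A u`. -/
noncomputable def qform {d : ℕ} (A : Matrix (Fin d) (Fin d) ℝ) (u : E d) : ℝ :=
  inner ℝ u (Matrix.toEuclideanCLM (n := Fin d) (𝕜 := ℝ) A u)

theorem qform_eq_sum {d : ℕ} (A : Matrix (Fin d) (Fin d) ℝ) (u : E d) :
    qform A u = ∑ i, ∑ j, A i j * (u i * u j) := by
  rw [qform, Matrix.inner_toEuclideanCLM]
  simp only [dotProduct, Matrix.mulVec, Finset.mul_sum]
  refine Finset.sum_congr rfl fun i _ => Finset.sum_congr rfl fun j _ => ?_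
  ring

theorem continuous_qform {d : ℕ} (A : Matrix (Fin d) (Fin d) ℝ) : Continuous (qform A) := by
  unfold qform; fun_prop

theorem qform_smul {d : ℕ} (A : Matrix (Fin d) (Fin d) ℝ) (s : ℝ) (u : E d) :
    qform A (s • u) = s ^ 2 * qform A u := by
  simp only [qform, map_smul, inner_smul_left, inner_smul_right]
  simp; ring

theorem exists_factor {d : ℕ} {H : Matrix (Fin d) (Fin d) ℝ} (hH : H.PosDef) :
    ∃ B : Matrix (Fin d) (Fin d) ℝ, H = B.conjTranspose * B := by
  open scoped MatrixOrder in
  exact (CStarAlgebra.nonneg_iff_eq_star_mul_self.1 hH.posSemidef.nonneg)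

theorem qform_conjTranspose_mul_self {d : ℕ} (B : Matrix (Fin d) (Fin d) ℝ) (u : E d) :
    qform (B.conjTranspose * B) u = ‖Matrix.toEuclideanCLM (n := Fin d) (𝕜 := ℝ) B u‖ ^ 2 := by
  rw [qform, ← Matrix.star_eq_conjTranspose, map_mul, map_star,
    ContinuousLinearMap.star_eq_adjoint, mul_apply_eq_comp,
    ContinuousLinearMap.adjoint_inner_right, real_inner_self_eq_norm_sq]

theorem exists_mul_sq_norm_le_qform {d : ℕ} {H : Matrix (Fin d) (Fin d) ℝ} (hH : H.PosDef) :
    ∃ κ > 0, ∀ u, κ * ‖u‖ ^ 2 ≤ qform H u := by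
  obtain ⟨B, rfl⟩ := exists_factor hH
  have hdet := hH.det_pos.ne'
  rw [Matrix.det_mul] at hdet
  have hB : IsUnit B.det := isUnit_iff_ne_zero.2 (right_ne_zero_of_mul hdet)
  set T := Matrix.toEuclideanCLM (n := Fin d) (𝕜 := ℝ) B
  set S := Matrix.toEuclideanCLM (n := Fin d) (𝕜 := ℝ) B⁻¹
  refine ⟨((‖S‖ + 1) ^ 2)⁻¹, by positivity, fun u => ?_⟩
  rw [qform_conjTranspose_mul_self, inv_mul_le_iff₀ (by positivity), ← mul_pow]
  have : S (T u) = u := by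
    rw [← mul_apply_eq_comp, ← map_mul, Matrix.nonsing_inv_mul _ hB, map_one]
    rfl
  have h1 : ‖u‖ ≤ ‖S‖ * ‖T u‖ := by
    conv_lhs => rw [← this]
    exact S.le_opNorm _
  have : ‖u‖ ≤ (‖S‖ + 1) * ‖T u‖ := by nlinarith [norm_nonneg (T u)]
  gcongr

theorem integral_exp_neg_qform {d : ℕ} {H : Matrix (Fin d) (Fin d) ℝ} (hH : H.PosDef) :
    ∫ u : E d, Real.exp (-(qform H u / 2)) =
      (Real.sqrt H.det)⁻¹ * (2 * Real.pi) ^ ((d : ℝ) / 2) := by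
  obtain ⟨B, hB⟩ := exists_factor hH
  have hd : H.det = B.det ^ 2 := by rw [hB, Matrix.det_mul, Matrix.det_conjTranspose]; simp [sq]
  have hB0 : B.det ≠ 0 := by
    intro h
    have := hH.det_pos
    rw [hd, h] at this; simp at this
  set T := Matrix.toEuclideanLin (𝕜 := ℝ) B with hT
  have hdet : LinearMap.det T = B.det := by
    rw [hT, Matrix.toEuclideanLin_eq_toLin_orthonormal, LinearMap.det_toLin]
  have hmap := Measure.map_linearMap_addHaar_eq_smul_addHaar (volume : Measure (E d))
    (f := T) (by rwa [hdet])
  have hg : ∀ u : E d, Real.exp (-(qform H u / 2)) = Real.exp (-(1 / 2 : ℝ) * ‖T u‖ ^ 2) := by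
    intro u
    rw [hB, qform_conjTranspose_mul_self]
    have : Matrix.toEuclideanCLM (n := Fin d) (𝕜 := ℝ) B u = T u := by
      rw [hT, ← Matrix.coe_toEuclideanCLM_eq_toEuclideanLin]; rfl
    rw [this]; congr 1; ring
  simp_rw [hg]
  have hTm : Measurable T := T.continuous_of_finiteDimensional.measurable
  rw [← integral_map (μ := volume) (φ := T) hTm.aemeasurable
    (f := fun v : E d => Real.exp (-(1 / 2 : ℝ) * ‖v‖ ^ 2)) (by fun_prop), hmap,
    integral_smul_measure, GaussianFourier.integral_rexp_neg_mul_sq_norm (by norm_num), hdet, hd,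
    Real.sqrt_sq_eq_abs]
  simp [abs_inv, mul_comm]

theorem hasFDerivAt_qform {d : ℕ} {H : Matrix (Fin d) (Fin d) ℝ} (hH : H.IsHermitian) (u : E d) :
    HasFDerivAt (qform H)
      ((2 : ℝ) • innerSL ℝ (Matrix.toEuclideanCLM (n := Fin d) (𝕜 := ℝ) H u)) u := by
  set T := Matrix.toEuclideanCLM (n := Fin d) (𝕜 := ℝ) H with hT
  have h := (hasFDerivAt_id (𝕜 := ℝ) u).inner ℝ (T.hasFDerivAt (x := u))
  refine h.congr_fderiv ?_
  ext v
  have hs : inner ℝ u (T v) = inner ℝ (T u) v := by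
    have : T = ContinuousLinearMap.adjoint T := by
      rw [← ContinuousLinearMap.star_eq_adjoint, hT, ← map_star]
      congr 1
      exact hH.eq.symm
    rw [← ContinuousLinearMap.adjoint_inner_left, ← this]
  simp only [id, ContinuousLinearMap.comp_apply, ContinuousLinearMap.prod_apply,
    fderivInnerCLM_apply, _root_.smul_apply, innerSL_apply_apply, smul_eq_mul,
    ContinuousLinearMap.id_apply]
  rw [hs, real_inner_comm v (T u)]
  ring

theorem abs_apply_le_norm {d : ℕ} (u : E d) (i : Fin d) : |u i| ≤ ‖u‖ := by
  simpa using PiLp.norm_apply_le u i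

theorem integrable_exp_neg_qform_mul {d k : ℕ} {H : Matrix (Fin d) (Fin d) ℝ} (hH : H.PosDef)
    {g : E d → ℝ} (hg : Continuous g) {C : ℝ} (hC : ∀ u, |g u| ≤ C * ‖u‖ ^ k) :
    Integrable fun u : E d => Real.exp (-(qform H u / 2)) * g u := by
  obtain ⟨κ, hκ, hle⟩ := exists_mul_sq_norm_le_qform hH
  have hi := (integrable_pow_norm_mul_exp_neg (d := d) k (b := κ / 2) (by positivity)).const_mul C
  refine hi.mono' ?_ (ae_of_all _ fun u => ?_)
  · have := continuous_qform H
    exact Continuous.aestronglyMeasurable (by fun_prop)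
  · rw [norm_mul, Real.norm_of_nonneg (Real.exp_nonneg _), Real.norm_eq_abs, ← mul_assoc, mul_comm]
    refine mul_le_mul (hC u) ?_ (Real.exp_nonneg _) ((abs_nonneg _).trans (hC u))
    rw [Real.exp_le_exp]
    linarith [hle u]

theorem integral_exp_neg_qform_mul_coord {d : ℕ} {H : Matrix (Fin d) (Fin d) ℝ} (hH : H.PosDef)
    (i j : Fin d) :
    ∫ u : E d, Real.exp (-(qform H u / 2)) * (u i * u j) =
      (∫ u : E d, Real.exp (-(qform H u / 2))) * H⁻¹ i j := by
  set T := Matrix.toEuclideanCLM (n := Fin d) (𝕜 := ℝ) H with hT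
  set w : E d := Matrix.toEuclideanCLM (n := Fin d) (𝕜 := ℝ) H⁻¹ (bvec d j) with hw
  have hunit : IsUnit H.det := isUnit_iff_ne_zero.2 hH.det_pos.ne'
  have hTw : T w = bvec d j := by
    rw [hw, hT, ← mul_apply_eq_comp, ← map_mul, Matrix.mul_nonsing_inv _ hunit, map_one]
    rfl
  have hwi : w i = H⁻¹ i j := by
    rw [hw, Matrix.ofLp_toEuclideanCLM]
    simp [bvec]
  have hself : T = ContinuousLinearMap.adjoint T := by
    rw [← ContinuousLinearMap.star_eq_adjoint, hT, ← map_star]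
    congr 1
    exact hH.1.eq.symm
  have hd1 : ∀ u : E d, HasFDerivAt (fun u : E d => Real.exp (-(qform H u / 2)))
      (Real.exp (-(qform H u / 2)) • -((2 : ℝ)⁻¹ • ((2 : ℝ) • innerSL ℝ (T u)))) u := by
    intro u
    have := ((hasFDerivAt_qform hH.1 u).mul_const (2 : ℝ)⁻¹).fun_neg.exp
    simpa only [div_eq_mul_inv] using this
  have hd2 : ∀ u : E d, HasFDerivAt (fun u : E d => u i) (EuclideanSpace.proj (𝕜 := ℝ) i) u :=
    fun u => (EuclideanSpace.proj (𝕜 := ℝ) i).hasFDerivAt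
  have e1 : ∀ u : E d, fderiv ℝ (fun u : E d => Real.exp (-(qform H u / 2))) u w =
      -(Real.exp (-(qform H u / 2)) * u j) := by
    intro u
    rw [(hd1 u).fderiv]
    have : inner ℝ (T u) w = u j := by
      have h2 : inner ℝ (T u) w = inner ℝ u (T w) := by
        conv_rhs => rw [hself]
        rw [ContinuousLinearMap.adjoint_inner_right]
      rw [h2, hTw, bvec, EuclideanSpace.inner_single_right]
      simp
    simp [this]
  have e2 : ∀ u : E d, fderiv ℝ (fun u : E d => u i) u w = H⁻¹ i j := by
    intro u
    rw [(hd2 u).fderiv, ← hwi]; rfl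
  have hc : ∀ l : Fin d, Continuous fun u : E d => u l := fun l => by fun_prop
  have key := integral_mul_fderiv_eq_neg_fderiv_mul_of_integrable (μ := (volume : Measure (E d)))
    (f := fun u : E d => Real.exp (-(qform H u / 2))) (g := fun u : E d => u i) (v := w)
    (by
      simp only [e1]
      have := integrable_exp_neg_qform_mul (k := 2) (C := 1) hH (g := fun u => -(u j * u i))
        (by fun_prop) (fun u => by
          rw [abs_neg, abs_mul, one_mul, sq]
          exact mul_le_mul (abs_apply_le_norm u j) (abs_apply_le_norm u i) (abs_nonneg _)
            (norm_nonneg _))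
      refine this.congr (ae_of_all _ fun u => ?_)
      simp only; ring)
    (by
      simp only [e2]
      exact integrable_exp_neg_qform_mul (k := 0) (C := |H⁻¹ i j|) hH (by fun_prop) (by simp))
    (integrable_exp_neg_qform_mul (k := 1) (C := 1) hH (by fun_prop) fun u => by
      simpa using abs_apply_le_norm u i)
    (fun u _ => (hd1 u).differentiableAt) (fun u _ => (hd2 u).differentiableAt)
  simp only [e1, e2] at key
  rw [integral_mul_const, ← integral_neg] at key
  rw [key]
  congr 1
  ext u
  ring

theorem integral_exp_neg_qform_mul_qform {d : ℕ} {H : Matrix (Fin d) (Fin d) ℝ} (hH : H.PosDef)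
    (A : Matrix (Fin d) (Fin d) ℝ) :
    ∫ u : E d, Real.exp (-(qform H u / 2)) * qform A u =
      (∫ u : E d, Real.exp (-(qform H u / 2))) * (H⁻¹ * A).trace := by
  have hi : ∀ i j : Fin d,
      Integrable fun u : E d => Real.exp (-(qform H u / 2)) * (A i j * (u i * u j)) := fun i j =>
    integrable_exp_neg_qform_mul (k := 2) (C := |A i j|) hH (by fun_prop) fun u => by
      rw [abs_mul, abs_mul, sq]
      gcongr <;> exact abs_apply_le_norm _ _
  simp_rw [qform_eq_sum A, Finset.mul_sum]
  rw [integral_finsetSum _ fun i _ => integrable_finsetSum _ fun j _ => hi i j]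
  simp_rw [integral_finsetSum Finset.univ fun j _ => hi _ j]
  have : ∀ i j, ∫ u : E d, Real.exp (-(qform H u / 2)) * (A i j * (u i * u j)) =
      (∫ u : E d, Real.exp (-(qform H u / 2))) * (H⁻¹ j i * A i j) := by
    intro i j
    have hs : H⁻¹ i j = H⁻¹ j i := by simpa using (hH.1.inv.apply j i)
    rw [← hs, mul_comm (H⁻¹ i j), mul_left_comm, ← integral_exp_neg_qform_mul_coord hH i j,
      ← integral_const_mul]
    congr 1; ext u; ring
  simp_rw [this]
  rw [Matrix.trace, Finset.sum_comm]
  simp [Matrix.mul_apply, Finset.mul_sum]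

/-- Laplace's method around a nondegenerate, well-separated minimum with value `0`. -/
theorem laplace_tendsto {d k : ℕ} {h ρ ℓ Q : E d → ℝ} {xs : E d} (hh : Measurable h)
    (hhQ : (fun y => h (xs + y) - Q y) =o[𝓝 0] fun y : E d => ‖y‖ ^ 2)
    (hQs : ∀ (s : ℝ) u, Q (s • u) = s ^ 2 * Q u) {κ : ℝ} (hκ : 0 < κ)
    (hQκ : ∀ u, κ * ‖u‖ ^ 2 ≤ Q u)
    (hsep : ∀ r > 0, ∃ η > 0, ∀ x, r ≤ ‖x - xs‖ → η ≤ h x)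
    (hρ : Measurable ρ) {Cρ : ℝ} (hρC : ∀ᶠ y in 𝓝 (0 : E d), |ρ (xs + y)| ≤ Cρ * ‖y‖ ^ k)
    (hℓ : ∀ u, Tendsto (fun t : ℝ => t ^ k * ρ (xs + t⁻¹ • u)) atTop (𝓝 (ℓ u)))
    {β : ℝ} (hint : Integrable fun x => Real.exp (-β * h x) * ρ x) :
    Tendsto (fun t : ℝ => t ^ (d + k) * ∫ x, Real.exp (-t ^ 2 * h x) * ρ x) atTop
      (𝓝 (∫ u, Real.exp (-Q u) * ℓ u)) := by
  have hlow : ∀ᶠ y in 𝓝 (0 : E d), κ / 2 * ‖y‖ ^ 2 ≤ h (xs + y) := by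
    filter_upwards [hhQ.def (half_pos hκ)] with y hy
    rw [Real.norm_eq_abs, norm_pow, norm_norm] at hy
    linarith [neg_abs_le (h (xs + y) - Q y), hQκ y]
  obtain ⟨δ, hδ, hball⟩ := Metric.eventually_nhds_iff_ball.1 (hlow.and hρC)
  obtain ⟨η, hη, hfar⟩ := hsep δ hδ
  have hnn : ∀ x, 0 ≤ h x := by
    intro x
    by_cases hx : δ ≤ ‖x - xs‖
    · exact hη.le.trans (hfar x hx)
    · have := (hball (x - xs) (by simpa using hx)).1
      rw [add_sub_cancel] at this
      exact le_trans (by positivity) this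
  set B := Metric.ball xs δ with hB
  have hintt : ∀ t : ℝ, β ≤ t ^ 2 → Integrable fun x => Real.exp (-t ^ 2 * h x) * ρ x := by
    intro t ht
    refine hint.mono (by fun_prop) (ae_of_all _ fun x => ?_)
    rw [norm_mul, norm_mul, Real.norm_of_nonneg (Real.exp_nonneg _),
      Real.norm_of_nonneg (Real.exp_nonneg _)]
    gcongr
    exact hnn x
  have hfarT : Tendsto (fun t : ℝ => t ^ (d + k) * ∫ x in Bᶜ, Real.exp (-t ^ 2 * h x) * ρ x)
      atTop (𝓝 0) := by
    set I := ∫ x, ‖Real.exp (-β * h x) * ρ x‖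
    have hb : Tendsto (fun t : ℝ => t ^ (d + k) * Real.exp (-η * t) * (Real.exp (β * η) * I))
        atTop (𝓝 0) := by
      have := (Real.tendsto_pow_mul_exp_neg_atTop_nhds_zero (d + k)).comp
        (tendsto_id.const_mul_atTop hη)
      have h2 := (this.const_mul ((η ^ (d + k))⁻¹)).mul_const (Real.exp (β * η) * I)
      simp only [mul_zero, zero_mul] at h2
      refine h2.congr fun t => ?_
      simp only [Function.comp, id, mul_pow]
      field_simp
    refine squeeze_zero_norm' ?_ hb
    filter_upwards [eventually_ge_atTop 1, eventually_ge_atTop β] with t ht1 htβ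
    have htβ2 : β ≤ t ^ 2 := htβ.trans (by nlinarith)
    rw [norm_mul, norm_pow, Real.norm_of_nonneg (by linarith : 0 ≤ t), mul_assoc]
    gcongr
    calc ‖∫ x in Bᶜ, Real.exp (-t ^ 2 * h x) * ρ x‖
        ≤ ∫ x in Bᶜ, ‖Real.exp (-t ^ 2 * h x) * ρ x‖ := norm_integral_le_integral_norm _
      _ ≤ ∫ x in Bᶜ, Real.exp (-η * t) * Real.exp (β * η) * ‖Real.exp (-β * h x) * ρ x‖ := by
          refine setIntegral_mono_on (hintt t htβ2).norm.integrableOn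
            (hint.norm.const_mul _).integrableOn Metric.isOpen_ball.measurableSet.compl ?_
          intro x hx
          rw [norm_mul, norm_mul, Real.norm_of_nonneg (Real.exp_nonneg _),
            Real.norm_of_nonneg (Real.exp_nonneg _), ← mul_assoc, ← Real.exp_add, ← Real.exp_add]
          gcongr
          have : η ≤ h x := hfar x (by simpa [hB, dist_eq_norm] using hx)
          have : t ≤ t ^ 2 := by nlinarith
          nlinarith
      _ ≤ Real.exp (-η * t) * (Real.exp (β * η) * I) := by
          rw [integral_const_mul, mul_assoc]
          gcongr
          exact setIntegral_le_integral hint.norm (ae_of_all _ fun x => norm_nonneg _)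
  have hnear : Tendsto (fun t : ℝ => t ^ (d + k) * ∫ x in B, Real.exp (-t ^ 2 * h x) * ρ x)
      atTop (𝓝 (∫ u, Real.exp (-Q u) * ℓ u)) := by
    let G : ℝ → E d → ℝ := fun t y =>
      (Metric.ball (0 : E d) δ).indicator (fun y => Real.exp (-t ^ 2 * h (xs + y)) * ρ (xs + y)) y
    have hG : ∀ᶠ t : ℝ in atTop, ∫ u, t ^ k * G t (t⁻¹ • u) =
        t ^ (d + k) * ∫ x in B, Real.exp (-t ^ 2 * h x) * ρ x := by
      filter_upwards [eventually_gt_atTop 0] with t ht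
      rw [integral_const_mul, Measure.integral_comp_inv_smul, finrank_euclideanSpace_fin,
        abs_of_pos (pow_pos ht d), smul_eq_mul, ← integral_indicator Metric.isOpen_ball.measurableSet,
        ← integral_add_left_eq_self (B.indicator _) xs, pow_add]
      have : ∀ y, B.indicator (fun x => Real.exp (-t ^ 2 * h x) * ρ x) (xs + y) = G t y := by
        intro y
        simp only [G, Set.indicator, hB, Metric.mem_ball, dist_eq_norm, add_sub_cancel_left,
          sub_zero]
      simp_rw [this]
      ring
    refine Tendsto.congr' hG ?_
    refine tendsto_integral_filter_of_dominated_convergence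
      (fun u => Cρ * (‖u‖ ^ k * Real.exp (-(κ / 2) * ‖u‖ ^ 2))) ?_ ?_
      ((integrable_pow_norm_mul_exp_neg k (half_pos hκ)).const_mul Cρ) ?_
    · refine Eventually.of_forall fun t => Measurable.aestronglyMeasurable ?_
      have hGm : Measurable (G t) :=
        Measurable.indicator (by fun_prop) Metric.isOpen_ball.measurableSet
      exact (hGm.comp (measurable_const_smul _)).const_mul _
    · filter_upwards [eventually_gt_atTop 0] with t ht
      refine ae_of_all _ fun u => ?_
      rw [norm_mul, norm_pow, Real.norm_of_nonneg ht.le]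
      by_cases hu : t⁻¹ • u ∈ Metric.ball (0 : E d) δ
      · simp only [G, Set.indicator_of_mem hu]
        obtain ⟨h1, h2⟩ := hball _ hu
        have hnorm : ‖t⁻¹ • u‖ = t⁻¹ * ‖u‖ := by
          rw [norm_smul, norm_inv, Real.norm_of_nonneg ht.le]
        rw [norm_mul, Real.norm_of_nonneg (Real.exp_nonneg _), Real.norm_eq_abs]
        have h3 : Real.exp (-t ^ 2 * h (xs + t⁻¹ • u)) ≤ Real.exp (-(κ / 2) * ‖u‖ ^ 2) := by
          rw [Real.exp_le_exp]
          have : t ^ 2 * (κ / 2 * ‖t⁻¹ • u‖ ^ 2) ≤ t ^ 2 * h (xs + t⁻¹ • u) := by gcongr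
          have h4 : t ^ 2 * (κ / 2 * ‖t⁻¹ • u‖ ^ 2) = κ / 2 * ‖u‖ ^ 2 := by
            rw [hnorm]; field_simp
          linarith
        calc t ^ k * (Real.exp (-t ^ 2 * h (xs + t⁻¹ • u)) * |ρ (xs + t⁻¹ • u)|)
            ≤ t ^ k * (Real.exp (-(κ / 2) * ‖u‖ ^ 2) * (Cρ * ‖t⁻¹ • u‖ ^ k)) := by gcongr
          _ = _ := by rw [hnorm, mul_pow, inv_pow]; field_simp
      · simp only [G, Set.indicator_of_notMem hu, norm_zero, mul_zero]
        have hC : 0 ≤ Cρ * ‖u‖ ^ k := by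
          rcases eq_or_ne u 0 with rfl | hu0
          · exact absurd (by simpa using hδ) hu
          · by_contra hneg
            have hup : 0 < ‖u‖ := norm_pos_iff.2 hu0
            have hCneg : Cρ < 0 := by
              by_contra hc
              exact hneg (by have := not_lt.1 hc; positivity)
            set z : E d := (δ / (2 * ‖u‖)) • u
            have hz : ‖z‖ = δ / 2 := by
              rw [norm_smul, Real.norm_of_nonneg (by positivity)]; field_simp
            have h5 := (hball z (by simp [hz]; linarith)).2
            have : 0 < ‖z‖ ^ k := by rw [hz]; positivity
            nlinarith [abs_nonneg (ρ (xs + z))]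
        rw [← mul_assoc]
        positivity
    · refine ae_of_all _ fun u => ?_
      have ht0 : Tendsto (fun t : ℝ => t⁻¹ • u) atTop (𝓝 0) := by
        have := (tendsto_inv_atTop_zero (𝕜 := ℝ)).smul_const u
        rwa [zero_smul] at this
      have hin : ∀ᶠ t : ℝ in atTop, t⁻¹ • u ∈ Metric.ball (0 : E d) δ :=
        ht0.eventually (Metric.ball_mem_nhds _ hδ)
      have hlim : Tendsto (fun t : ℝ => t ^ 2 * h (xs + t⁻¹ • u)) atTop (𝓝 (Q u)) := by
        have h1 : Tendsto (fun t : ℝ => t ^ 2 * (h (xs + t⁻¹ • u) - Q (t⁻¹ • u))) atTop (𝓝 0) := by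
          have h2 := (isBigO_refl (fun t : ℝ => t ^ 2) atTop).mul_isLittleO
            (hhQ.comp_tendsto ht0)
          have h3 : (fun t : ℝ => t ^ 2 * ((fun y : E d => ‖y‖ ^ 2) ∘ fun t : ℝ => t⁻¹ • u) t)
              =O[atTop] fun _ => (1 : ℝ) := by
            refine IsBigO.of_bound (‖u‖ ^ 2) ?_
            filter_upwards [eventually_gt_atTop 0] with t ht
            simp only [Function.comp, norm_smul, norm_inv, norm_mul, norm_pow, norm_norm, norm_one,
              mul_one]
            rw [Real.norm_of_nonneg ht.le]
            apply le_of_eq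
            field_simp
          exact (isLittleO_one_iff ℝ).1 (h2.trans_isBigO h3)
        have h4 := h1.add_const (Q u)
        rw [zero_add] at h4
        refine h4.congr' ?_
        filter_upwards [eventually_gt_atTop 0] with t ht
        rw [hQs]
        field_simp
        ring
      have hmain : Tendsto (fun t : ℝ => Real.exp (-(t ^ 2 * h (xs + t⁻¹ • u))) *
          (t ^ k * ρ (xs + t⁻¹ • u))) atTop (𝓝 (Real.exp (-Q u) * ℓ u)) :=
        ((Real.continuous_exp.tendsto _).comp hlim.neg).mul (hℓ u)
      refine hmain.congr' ?_
      filter_upwards [hin] with t ht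
      simp only [G, Set.indicator_of_mem ht]
      rw [neg_mul]; ring
  have hsum := hnear.add hfarT
  rw [add_zero] at hsum
  refine hsum.congr' ?_
  filter_upwards [eventually_ge_atTop 1, eventually_ge_atTop β] with t ht1 htβ
  rw [← mul_add, integral_add_compl Metric.isOpen_ball.measurableSet
    (hintt t (htβ.trans (by nlinarith)))]

theorem sum_smul_bvec {d : ℕ} (u : E d) : ∑ i, u i • bvec d i = u := by
  have := (EuclideanSpace.basisFun (Fin d) ℝ).sum_repr u
  simpa [bvec] using this

theorem hess_apply {d : ℕ} (ψ : E d → ℝ) (x : E d) (i j : Fin d) :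
    hess ψ x i j = fderiv ℝ (fderiv ℝ ψ) x (bvec d i) (bvec d j) := by
  simp [hess, iteratedFDeriv_two_apply]

theorem fderiv_fderiv_apply_self {d : ℕ} (ψ : E d → ℝ) (x u : E d) :
    fderiv ℝ (fderiv ℝ ψ) x u u = qform (hess ψ x) u := by
  conv_lhs => rw [← sum_smul_bvec u]
  rw [qform_eq_sum]
  simp only [map_sum, map_smul, _root_.sum_apply, _root_.smul_apply,
    smul_eq_mul, hess_apply, Finset.mul_sum]
  rw [Finset.sum_comm]
  refine Finset.sum_congr rfl fun i _ => Finset.sum_congr rfl fun j _ => ?_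
  ring

theorem Objective.fderiv_eq_zero {d : ℕ} {f : E d → ℝ} {xs : E d} (hf : Objective f xs) :
    fderiv ℝ f xs = 0 := by
  apply IsLocalMin.fderiv_eq_zero
  refine Eventually.of_forall fun x => ?_
  rcases eq_or_ne x xs with rfl | h
  · exact le_rfl
  · exact (hf.unique_min x h).le

theorem Objective.taylor {d : ℕ} {f : E d → ℝ} {xs : E d} (hf : Objective f xs) :
    (fun y => (f (xs + y) - f xs) - qform (hess f xs) y / 2) =o[𝓝 0] fun y : E d => ‖y‖ ^ 2 := by
  have hfd : fderiv ℝ (fun x => f x - f xs) = fderiv ℝ f := by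
    ext1 x; exact fderiv_sub_const _
  have hs : ContDiff ℝ 2 (fun x => f x - f xs) :=
    (hf.smooth.of_le (by norm_num)).sub contDiff_const
  have := taylor_two_isLittleO (ρ := fun x => f x - f xs) (x := xs)
    hs.contDiffAt (by simp) (by rw [hfd, hf.fderiv_eq_zero])
  simpa only [hfd, fderiv_fderiv_apply_self] using this

/-- The Gaussian normalisation `∫ exp(-uᵀ H u / 2) du` at the minimizer. -/
noncomputable def gaussConst {d : ℕ} (f : E d → ℝ) (xs : E d) : ℝ :=
  ∫ u : E d, Real.exp (-(qform (hess f xs) u / 2))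

theorem Objective.laplace_tendsto {d k : ℕ} {f : E d → ℝ} {xs : E d} (hf : Objective f xs)
    {ρ ℓ : E d → ℝ} (hρ : Measurable ρ) {Cρ : ℝ}
    (hρC : ∀ᶠ y in 𝓝 (0 : E d), |ρ (xs + y)| ≤ Cρ * ‖y‖ ^ k)
    (hℓ : ∀ u, Tendsto (fun t : ℝ => t ^ k * ρ (xs + t⁻¹ • u)) atTop (𝓝 (ℓ u)))
    {β : ℝ} (hint : Integrable fun x => Real.exp (-β * (f x - f xs)) * ρ x) :
    Tendsto (fun t : ℝ => t ^ (d + k) * ∫ x, Real.exp (-t ^ 2 * (f x - f xs)) * ρ x) atTop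
      (𝓝 (∫ u, Real.exp (-(qform (hess f xs) u / 2)) * ℓ u)) := by
  obtain ⟨κ, hκ, hle⟩ := exists_mul_sq_norm_le_qform hf.hess_pos
  have hfm := hf.smooth.continuous.measurable
  refine LISO.laplace_tendsto (h := fun x => f x - f xs) (Q := fun u => qform (hess f xs) u / 2)
    (by fun_prop) hf.taylor (fun s u => ?_) (κ := κ / 2) (by positivity) (fun u => ?_)
    (fun r hr => ?_) hρ hρC hℓ hint
  · rw [qform_smul]; ring
  · have := hle u
    linarith
  · obtain ⟨η, hη, h⟩ := hf.separated r hr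
    exact ⟨η, hη, fun x hx => by linarith [h x hx]⟩

theorem Objective.laplace_tendsto_of_continuous {d : ℕ} {f : E d → ℝ} {xs : E d}
    (hf : Objective f xs) {ρ : E d → ℝ} (hρ : Continuous ρ)
    {β : ℝ} (hint : Integrable fun x => Real.exp (-β * (f x - f xs)) * ρ x) :
    Tendsto (fun t : ℝ => t ^ d * ∫ x, Real.exp (-t ^ 2 * (f x - f xs)) * ρ x) atTop
      (𝓝 (gaussConst f xs * ρ xs)) := by
  have hc : Tendsto (fun y : E d => ρ (xs + y)) (𝓝 0) (𝓝 (ρ xs)) := by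
    have : Continuous fun y : E d => ρ (xs + y) := by fun_prop
    simpa using this.tendsto 0
  have := hf.laplace_tendsto (k := 0) (ℓ := fun _ => ρ xs) hρ.measurable (Cρ := |ρ xs| + 1)
    (by
      filter_upwards [hc.abs.eventually (eventually_lt_nhds (lt_add_one |ρ xs|))] with y hy
      simpa using hy.le)
    (fun u => by
      have ht0 : Tendsto (fun t : ℝ => t⁻¹ • u) atTop (𝓝 0) := by
        have := (tendsto_inv_atTop_zero (𝕜 := ℝ)).smul_const u
        rwa [zero_smul] at this
      simpa [Function.comp_def] using hc.comp ht0) hint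
  rw [integral_mul_const] at this
  simpa [gaussConst] using this

theorem Objective.laplace_tendsto_of_critical {d : ℕ} {f : E d → ℝ} {xs : E d}
    (hf : Objective f xs) {ρ : E d → ℝ} (hρ : Measurable ρ) (hs : ContDiffAt ℝ 2 ρ xs)
    (h0 : ρ xs = 0) (h1 : fderiv ℝ ρ xs = 0)
    {β : ℝ} (hint : Integrable fun x => Real.exp (-β * (f x - f xs)) * ρ x) :
    Tendsto (fun t : ℝ => t ^ (d + 2) * ∫ x, Real.exp (-t ^ 2 * (f x - f xs)) * ρ x) atTop
      (𝓝 (gaussConst f xs * (((hess f xs)⁻¹ * hess ρ xs).trace / 2))) := by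
  have hT := taylor_two_isLittleO hs h0 h1
  simp only [fderiv_fderiv_apply_self] at hT
  have hbound : ∃ C, ∀ u : E d, |qform (hess ρ xs) u / 2| ≤ C * ‖u‖ ^ 2 := by
    refine ⟨‖Matrix.toEuclideanCLM (n := Fin d) (𝕜 := ℝ) (hess ρ xs)‖ / 2, fun u => ?_⟩
    rw [abs_div, qform, abs_two]
    have h2 := abs_real_inner_le_norm u
      (Matrix.toEuclideanCLM (n := Fin d) (𝕜 := ℝ) (hess ρ xs) u)
    have h3 := (Matrix.toEuclideanCLM (n := Fin d) (𝕜 := ℝ) (hess ρ xs)).le_opNorm u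
    have : ‖u‖ * ‖Matrix.toEuclideanCLM (n := Fin d) (𝕜 := ℝ) (hess ρ xs) u‖ ≤
      ‖u‖ * (‖Matrix.toEuclideanCLM (n := Fin d) (𝕜 := ℝ) (hess ρ xs)‖ * ‖u‖) := by gcongr
    nlinarith
  obtain ⟨C, hC⟩ := hbound
  have := hf.laplace_tendsto (k := 2) (ℓ := fun u => qform (hess ρ xs) u / 2) hρ (Cρ := C + 1)
    (by
      filter_upwards [hT.def one_pos] with y hy
      rw [Real.norm_eq_abs, norm_pow, norm_norm] at hy
      have := hC y
      calc |ρ (xs + y)| = |(ρ (xs + y) - qform (hess ρ xs) y / 2) + qform (hess ρ xs) y / 2| := by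
            ring_nf
        _ ≤ _ := abs_add_le _ _
        _ ≤ _ := by linarith)
    (fun u => by
      have ht0 : Tendsto (fun t : ℝ => t⁻¹ • u) atTop (𝓝 0) := by
        have := (tendsto_inv_atTop_zero (𝕜 := ℝ)).smul_const u
        rwa [zero_smul] at this
      have h2 := (isBigO_refl (fun t : ℝ => t ^ 2) atTop).mul_isLittleO (hT.comp_tendsto ht0)
      have h3 : (fun t : ℝ => t ^ 2 * ((fun y : E d => ‖y‖ ^ 2) ∘ fun t : ℝ => t⁻¹ • u) t)
          =O[atTop] fun _ => (1 : ℝ) := by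
        refine IsBigO.of_bound (‖u‖ ^ 2) ?_
        filter_upwards [eventually_gt_atTop 0] with t ht
        simp only [Function.comp, norm_smul, norm_inv, norm_mul, norm_pow, norm_norm, norm_one,
          mul_one]
        rw [Real.norm_of_nonneg ht.le]
        apply le_of_eq
        field_simp
      have h4 := ((isLittleO_one_iff ℝ).1 (h2.trans_isBigO h3)).add_const
        (qform (hess ρ xs) u / 2)
      rw [zero_add] at h4
      refine h4.congr' ?_
      filter_upwards [eventually_gt_atTop 0] with t ht
      simp only [Function.comp, qform_smul]
      field_simp
      ring) hint
  convert this using 2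
  rw [gaussConst, ← mul_div_assoc, ← integral_exp_neg_qform_mul_qform hf.hess_pos,
    ← integral_div]
  congr 1; ext u; ring

theorem fderiv_fderiv_apply_right {d : ℕ} {f : E d → ℝ} (hf : ContDiff ℝ 3 f) (v x a b : E d) :
    fderiv ℝ (fderiv ℝ fun y => fderiv ℝ f y v) x a b =
      fderiv ℝ (fderiv ℝ (fderiv ℝ f)) x a b v := by
  have h1 : ContDiff ℝ 2 (fderiv ℝ f) := hf.fderiv_right (by norm_num)
  have h2 : ContDiff ℝ 1 (fderiv ℝ (fderiv ℝ f)) := h1.fderiv_right (by norm_num)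
  have e1 : (fderiv ℝ fun y => fderiv ℝ f y v) =
      fun y => (fderiv ℝ (fderiv ℝ f) y).flip v := by
    ext y w
    have := (h1.differentiable (by simp) y).hasFDerivAt.clm_apply (hasFDerivAt_const v y)
    rw [this.fderiv]; simp
  rw [e1]
  let T : (E d →L[ℝ] E d →L[ℝ] ℝ) →L[ℝ] (E d →L[ℝ] ℝ) :=
    (ContinuousLinearMap.apply ℝ (E d →L[ℝ] ℝ) v).comp
      (ContinuousLinearMap.flipₗᵢ ℝ (E d) (E d) ℝ).toContinuousLinearEquiv.toContinuousLinearMap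
  have h3 := (T.hasFDerivAt (x := fderiv ℝ (fderiv ℝ f) x)).comp x
    (h2.differentiable (by simp) x).hasFDerivAt
  have h4 : (fun y => (fderiv ℝ (fderiv ℝ f) y).flip v) = T ∘ fderiv ℝ (fderiv ℝ f) := rfl
  rw [h4, h3.fderiv]
  rfl

theorem third_fderiv_symm {d : ℕ} {f : E d → ℝ} (hf : ContDiff ℝ 3 f) (x a b c : E d) :
    fderiv ℝ (fderiv ℝ (fderiv ℝ f)) x a b c = fderiv ℝ (fderiv ℝ (fderiv ℝ f)) x b a c ∧
    fderiv ℝ (fderiv ℝ (fderiv ℝ f)) x a b c = fderiv ℝ (fderiv ℝ (fderiv ℝ f)) x a c b := by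
  have h1 : ContDiff ℝ 2 (fderiv ℝ f) := hf.fderiv_right (by norm_num)
  have h2 : ContDiff ℝ 1 (fderiv ℝ (fderiv ℝ f)) := h1.fderiv_right (by norm_num)
  constructor
  · have := (h1.contDiffAt (x := x)).isSymmSndFDerivAt (by simp) a b
    rw [this]
  · have hs : ∀ y, fderiv ℝ (fderiv ℝ f) y b c = fderiv ℝ (fderiv ℝ f) y c b := fun y =>
      (hf.contDiffAt (x := y)).isSymmSndFDerivAt
        (by rw [minSmoothness_of_isRCLikeNormedField]; norm_num) b c
    have hd : ∀ b c : E d, fderiv ℝ (fun y => fderiv ℝ (fderiv ℝ f) y b c) x a =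
        fderiv ℝ (fderiv ℝ (fderiv ℝ f)) x a b c := by
      intro b c
      have := (((h2.differentiable (by simp) x).hasFDerivAt.clm_apply
        (hasFDerivAt_const b x)).clm_apply (hasFDerivAt_const c x))
      rw [this.fderiv]; simp
    rw [← hd, ← hd]
    simp_rw [hs]

theorem iteratedFDeriv_three_apply {d : ℕ} (f : E d → ℝ) (x a b c : E d) :
    iteratedFDeriv ℝ 3 f x ![a, b, c] = fderiv ℝ (fderiv ℝ (fderiv ℝ f)) x a b c := by
  rw [iteratedFDeriv_succ_apply_right, iteratedFDeriv_two_apply]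
  rfl

/-- The direction `H⁻¹ ∇ψ(x⋆)`. -/
noncomputable def newtonDir {d : ℕ} (f : E d → ℝ) (xs : E d) (ψ : E d → ℝ) : E d :=
  Matrix.toEuclideanCLM (n := Fin d) (𝕜 := ℝ) (hess f xs)⁻¹ (WithLp.toLp 2 (grad ψ xs))

theorem Objective.fderiv_fderiv_newtonDir {d : ℕ} {f : E d → ℝ} {xs : E d} (hf : Objective f xs)
    (ψ : E d → ℝ) (u : E d) :
    fderiv ℝ (fderiv ℝ f) xs u (newtonDir f xs ψ) = fderiv ℝ ψ xs u := by
  have hunit : IsUnit (hess f xs).det := isUnit_iff_ne_zero.2 hf.hess_pos.det_pos.ne'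
  set v := newtonDir f xs ψ with hv
  have hHv : (hess f xs).mulVec v = grad ψ xs := by
    rw [hv, newtonDir, Matrix.ofLp_toEuclideanCLM, Matrix.mulVec_mulVec,
      Matrix.mul_nonsing_inv _ hunit, Matrix.one_mulVec]
  have hb : ∀ i, fderiv ℝ (fderiv ℝ f) xs (bvec d i) v = fderiv ℝ ψ xs (bvec d i) := by
    intro i
    have h1 : grad ψ xs i = fderiv ℝ ψ xs (bvec d i) := rfl
    rw [← h1, ← hHv]
    conv_lhs => rw [← sum_smul_bvec v]
    simp only [map_sum, map_smul, smul_eq_mul, Matrix.mulVec, dotProduct, hess_apply]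
    exact Finset.sum_congr rfl fun j _ => mul_comm _ _
  rw [← sum_smul_bvec u]
  simp only [map_sum, map_smul, _root_.sum_apply, _root_.smul_apply, hb]

theorem Objective.laplaceCoeff_eq_trace {d : ℕ} {f : E d → ℝ} {xs : E d} (hf : Objective f xs)
    {ψ : E d → ℝ} {A : Matrix (Fin d) (Fin d) ℝ}
    (hA : ∀ k l, A k l = hess ψ xs k l -
      fderiv ℝ (fderiv ℝ (fderiv ℝ f)) xs (bvec d k) (bvec d l) (newtonDir f xs ψ)) :
    ((hess f xs)⁻¹ * A).trace = laplaceCoeff f xs ψ := by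
  have hf3 : ContDiff ℝ 3 f := hf.smooth.of_le (by norm_num)
  set K := (hess f xs)⁻¹ with hK
  have hs : ∀ i j, K i j = K j i := fun i j => by simpa using (hf.hess_pos.1.inv.apply j i)
  set v := newtonDir f xs ψ with hv
  have hvi : ∀ i, v i = ∑ j, K i j * grad ψ xs j := fun i => rfl
  have h3 : ∀ k l, fderiv ℝ (fderiv ℝ (fderiv ℝ f)) xs (bvec d k) (bvec d l) v =
      ∑ i, v i * iteratedFDeriv ℝ 3 f xs ![bvec d i, bvec d l, bvec d k] := by
    intro k l
    conv_lhs => rw [← sum_smul_bvec v]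
    simp only [map_sum, map_smul, smul_eq_mul]
    refine Finset.sum_congr rfl fun i _ => ?_
    rw [iteratedFDeriv_three_apply, (third_fderiv_symm hf3 xs (bvec d k) _ _).2,
      (third_fderiv_symm hf3 xs (bvec d k) _ _).1, (third_fderiv_symm hf3 xs (bvec d i) _ _).2]
  have hptr : dotProduct (grad ψ xs) (K.mulVec (ptr3 f xs)) = ∑ i, v i * ptr3 f xs i := by
    simp only [dotProduct, Matrix.mulVec, hvi, Finset.mul_sum, Finset.sum_mul]
    rw [Finset.sum_comm]
    refine Finset.sum_congr rfl fun i _ => Finset.sum_congr rfl fun j _ => ?_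
    rw [hs i j]; ring
  rw [laplaceCoeff, hptr]
  simp only [Matrix.trace, Matrix.diag, Matrix.mul_apply, hA, h3, mul_sub, Finset.sum_sub_distrib,
    ptr3, Finset.mul_sum]
  congr 1
  calc _ = ∑ k, ∑ i, ∑ l, K k l *
        (v i * iteratedFDeriv ℝ 3 f xs ![bvec d i, bvec d k, bvec d l]) :=
        Finset.sum_congr rfl fun k _ => Finset.sum_comm
    _ = _ := by
        rw [Finset.sum_comm]
        refine Finset.sum_congr rfl fun i _ => Finset.sum_congr rfl fun k _ =>
          Finset.sum_congr rfl fun l _ => ?_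
        ring

/-- First-order Laplace asymptotics for a `C²` function vanishing at the minimizer. -/
theorem Objective.laplace_tendsto_of_contDiff {d : ℕ} {f : E d → ℝ} {xs : E d}
    (hf : Objective f xs) {ψ : E d → ℝ} (hs : ContDiff ℝ 2 ψ) (h0 : ψ xs = 0)
    {β : ℝ} (hint : Integrable fun x => Real.exp (-β * (f x - f xs)) * ψ x) :
    Tendsto (fun t : ℝ => t ^ (d + 2) * ∫ x, Real.exp (-t ^ 2 * (f x - f xs)) * ψ x) atTop
      (𝓝 (gaussConst f xs * (laplaceCoeff f xs ψ / 2))) := by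
  have hf3 : ContDiff ℝ 3 f := hf.smooth.of_le (by norm_num)
  have hfc := hf.smooth.continuous
  have hf' : ContDiff ℝ 2 (fderiv ℝ f) := hf3.fderiv_right (by norm_num)
  set v := newtonDir f xs ψ with hv
  let χ : ContDiffBump xs := ⟨1, 2, one_pos, one_lt_two⟩
  have hχ : ContDiff ℝ 2 χ := χ.contDiff
  have hDχ : Continuous fun x => fderiv ℝ χ x v :=
    (hχ.continuous_fderiv (by norm_num)).clm_apply continuous_const
  have hDf : ContDiff ℝ 2 fun x => fderiv ℝ f x v := hf'.clm_apply contDiff_const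
  let ρ : E d → ℝ := fun x => ψ x - χ x * fderiv ℝ f x v
  have hρ : ContDiff ℝ 2 ρ := hs.sub (hχ.mul hDf)
  have hρe : ρ =ᶠ[𝓝 xs] fun x => ψ x - fderiv ℝ f x v := by
    filter_upwards [χ.eventuallyEq_one] with x hx
    simp [ρ, hx]
  have hfd : ∀ᶠ x in 𝓝 xs, fderiv ℝ ρ x = fderiv ℝ ψ x - fderiv ℝ (fun x => fderiv ℝ f x v) x := by
    filter_upwards [hρe.eventuallyEq_nhds] with x hx
    rw [hx.fderiv_eq, fderiv_fun_sub (hs.differentiable (by norm_num) x)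
      (hDf.differentiable (by norm_num) x)]
  have hfd2 : fderiv ℝ (fderiv ℝ ρ) xs =
      fderiv ℝ (fderiv ℝ ψ) xs - fderiv ℝ (fderiv ℝ fun x => fderiv ℝ f x v) xs := by
    rw [EventuallyEq.fderiv_eq hfd]
    exact fderiv_fun_sub
      ((hs.fderiv_right (m := 1) (by norm_num)).differentiable (by norm_num) xs)
      ((hDf.fderiv_right (m := 1) (by norm_num)).differentiable (by norm_num) xs)
  have hρ1 : fderiv ℝ ρ xs = 0 := by
    rw [hfd.self_of_nhds]
    ext u
    have := (hf'.differentiable (by norm_num) xs).hasFDerivAt.clm_apply (hasFDerivAt_const v xs)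
    rw [this.fderiv]
    simp [hv, hf.fderiv_fderiv_newtonDir]
  have hcs : ∀ {g : E d → ℝ}, Continuous g → HasCompactSupport g → ∀ t : ℝ,
      Integrable fun x => Real.exp (-t * (f x - f xs)) * g x := by
    intro g hg hgs t
    exact Continuous.integrable_of_hasCompactSupport (by fun_prop) hgs.mul_left
  have hχf : Continuous fun x => χ x * fderiv ℝ f x v := hχ.continuous.mul hDf.continuous
  have hχfs : HasCompactSupport fun x => χ x * fderiv ℝ f x v := χ.hasCompactSupport.mul_right
  have hDχs : HasCompactSupport fun x => fderiv ℝ χ x v :=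
    χ.hasCompactSupport.fderiv_apply ℝ v
  have hρint : Integrable fun x => Real.exp (-β * (f x - f xs)) * ρ x := by
    refine (hint.sub (hcs hχf hχfs β)).congr (ae_of_all _ fun x => ?_)
    simp only [ρ, Pi.sub_apply]; ring
  have L1 := hf.laplace_tendsto_of_critical hρ.continuous.measurable hρ.contDiffAt
    (by simp [ρ, h0, hf.fderiv_eq_zero]) hρ1 hρint
  have L2 := hf.laplace_tendsto_of_continuous hDχ (hcs hDχ hDχs 0)
  have hχ0 : fderiv ℝ χ xs v = 0 := by
    rw [χ.eventuallyEq_one.fderiv_eq]; simp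
  rw [hχ0, mul_zero] at L2
  have htr : ((hess f xs)⁻¹ * hess ρ xs).trace = laplaceCoeff f xs ψ := by
    refine hf.laplaceCoeff_eq_trace fun k l => ?_
    rw [hess_apply, hess_apply, hfd2, ← fderiv_fderiv_apply_right hf3]
    rfl
  rw [htr] at L1
  have L3 := L1.add L2
  rw [add_zero] at L3
  refine L3.congr' ?_
  filter_upwards [eventually_ge_atTop 1, eventually_ge_atTop β] with t ht1 htβ
  have hgd : ∀ x, HasFDerivAt (fun x => Real.exp (-t ^ 2 * (f x - f xs)))
      (Real.exp (-t ^ 2 * (f x - f xs)) • ((-t ^ 2) • fderiv ℝ f x)) x := fun x =>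
    (((hf3.differentiable (by norm_num) x).hasFDerivAt.sub_const (f xs)).const_mul
      (-t ^ 2)).exp
  have hgv : ∀ x, fderiv ℝ (fun x => Real.exp (-t ^ 2 * (f x - f xs))) x v =
      -t ^ 2 * (Real.exp (-t ^ 2 * (f x - f xs)) * fderiv ℝ f x v) := by
    intro x
    rw [(hgd x).fderiv]
    simp only [_root_.smul_apply, smul_eq_mul]
    ring
  have i1 := hcs hDχ hDχs (t ^ 2)
  have i2 := hcs hχf hχfs (t ^ 2)
  have i3 := hcs hχ.continuous χ.hasCompactSupport (t ^ 2)
  have key := integral_mul_fderiv_eq_neg_fderiv_mul_of_integrable (μ := (volume : Measure (E d)))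
    (f := χ) (g := fun x => Real.exp (-t ^ 2 * (f x - f xs))) (v := v)
    (i1.congr (ae_of_all _ fun x => by simp only; ring))
    ((i2.const_mul (-t ^ 2)).congr (ae_of_all _ fun x => by simp only [hgv]; ring))
    (i3.congr (ae_of_all _ fun x => by simp only; ring))
    (fun x _ => hχ.differentiable (by norm_num) x) (fun x _ => (hgd x).differentiableAt)
  have hk : t ^ 2 * ∫ x, Real.exp (-t ^ 2 * (f x - f xs)) * (χ x * fderiv ℝ f x v) =
      ∫ x, Real.exp (-t ^ 2 * (f x - f xs)) * fderiv ℝ χ x v := by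
    rw [← integral_const_mul, ← neg_inj, ← integral_neg]
    rw [show (∫ x, Real.exp (-t ^ 2 * (f x - f xs)) * fderiv ℝ χ x v) =
      ∫ x, fderiv ℝ χ x v * Real.exp (-t ^ 2 * (f x - f xs)) from
        integral_congr_ae (ae_of_all _ fun x => mul_comm _ _), ← key]
    refine integral_congr_ae (ae_of_all _ fun x => ?_)
    simp only [hgv]; ring
  have hnn : ∀ x, 0 ≤ f x - f xs := fun x => by
    rcases eq_or_ne x xs with rfl | h
    · simp
    · linarith [hf.unique_min x h]
  have hρt : Integrable fun x => Real.exp (-t ^ 2 * (f x - f xs)) * ρ x := by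
    have := hρ.continuous
    refine hρint.mono (Continuous.aestronglyMeasurable (by fun_prop)) (ae_of_all _ fun x => ?_)
    rw [norm_mul, norm_mul, Real.norm_of_nonneg (Real.exp_nonneg _),
      Real.norm_of_nonneg (Real.exp_nonneg _)]
    have : β ≤ t ^ 2 := by nlinarith
    gcongr
    exact hnn x
  rw [← hk, pow_add, mul_assoc, ← mul_assoc (t ^ d), mul_assoc (t ^ d), ← mul_add (t ^ d), ← mul_add,
    ← integral_add hρt i2, mul_assoc]
  congr 3
  ext x
  simp only [ρ]; ring

theorem Objective.sub_nonneg {d : ℕ} {f : E d → ℝ} {xs : E d} (hf : Objective f xs) (x : E d) :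
    0 ≤ f x - f xs := by
  rcases eq_or_ne x xs with rfl | h
  · simp
  · linarith [hf.unique_min x h]

/-- `∫ exp(-α (f - f(x⋆))) ψ`. -/
noncomputable def laplaceInt {d : ℕ} (f : E d → ℝ) (xs : E d) (α : ℝ) (ψ : E d → ℝ) : ℝ :=
  ∫ x, Real.exp (-α * (f x - f xs)) * ψ x

/-- The normalisation `∫ exp(-α (f - f(x⋆)))`. -/
noncomputable def normConst {d : ℕ} (f : E d → ℝ) (xs : E d) (α : ℝ) : ℝ :=
  ∫ x, Real.exp (-α * (f x - f xs))

theorem integrable_exp_mul_of_le {d : ℕ} {f : E d → ℝ} {xs : E d} (hf : Objective f xs)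
    {V : Type*} [NormedAddCommGroup V] [NormedSpace ℝ V]
    {ψ : E d → V} (hψ : AEStronglyMeasurable ψ) {a b : ℝ} (hab : a ≤ b)
    (hi : Integrable fun x => Real.exp (-a * (f x - f xs)) • ψ x) :
    Integrable fun x => Real.exp (-b * (f x - f xs)) • ψ x := by
  have hc := hf.smooth.continuous
  refine hi.mono ?_ (ae_of_all _ fun x => ?_)
  · exact (Continuous.aestronglyMeasurable (by fun_prop)).smul hψ
  · rw [norm_smul, norm_smul, Real.norm_of_nonneg (Real.exp_nonneg _),
      Real.norm_of_nonneg (Real.exp_nonneg _)]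
    gcongr
    exact hf.sub_nonneg x

theorem Objective.integrable_exp {d : ℕ} {f : E d → ℝ} {xs : E d} (hf : Objective f xs)
    {α : ℝ} (hα : 1 ≤ α) : Integrable fun x => Real.exp (-α * (f x - f xs)) := by
  have h1 : Integrable fun x => Real.exp (-1 * (f x - f xs)) • (1 : ℝ) := by
    refine (hf.integrable.const_mul (Real.exp (f xs))).congr (ae_of_all _ fun x => ?_)
    simp only [smul_eq_mul, mul_one]
    rw [← Real.exp_add]; congr 1; ring
  simpa using integrable_exp_mul_of_le hf aestronglyMeasurable_const hα h1

theorem Objective.normConst_pos {d : ℕ} {f : E d → ℝ} {xs : E d} (hf : Objective f xs)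
    {α : ℝ} (hα : 1 ≤ α) : 0 < normConst f xs α := by
  unfold normConst
  exact integral_exp_pos (hf.integrable_exp hα)

theorem Objective.normConst_anti {d : ℕ} {f : E d → ℝ} {xs : E d} (hf : Objective f xs)
    {a b : ℝ} (ha : 1 ≤ a) (hab : a ≤ b) : normConst f xs b ≤ normConst f xs a := by
  refine integral_mono (hf.integrable_exp (ha.trans hab)) (hf.integrable_exp ha) fun x => ?_
  simp only
  gcongr
  exact hf.sub_nonneg x

theorem Objective.gaussConst_eq {d : ℕ} {f : E d → ℝ} {xs : E d} (hf : Objective f xs) :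
    gaussConst f xs = (Real.sqrt (hess f xs).det)⁻¹ * (2 * Real.pi) ^ ((d : ℝ) / 2) :=
  integral_exp_neg_qform hf.hess_pos

theorem Objective.gaussConst_pos {d : ℕ} {f : E d → ℝ} {xs : E d} (hf : Objective f xs) :
    0 < gaussConst f xs := by
  rw [hf.gaussConst_eq]
  have := Real.sqrt_pos.2 hf.hess_pos.det_pos
  positivity

theorem Objective.mconst_eq {d : ℕ} {f : E d → ℝ} {xs : E d} (hf : Objective f xs)
    {α : ℝ} (hα : 0 ≤ α) : mconst f xs α = α ^ ((d : ℝ) / 2) / gaussConst f xs := by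
  rw [hf.gaussConst_eq, mconst, Real.div_rpow hα (by positivity)]
  have := Real.sqrt_pos.2 hf.hess_pos.det_pos
  field_simp

theorem Objective.tendsto_laplaceInt_zero {d : ℕ} {f : E d → ℝ} {xs : E d}
    (hf : Objective f xs) {ψ : E d → ℝ} (hψ : Continuous ψ)
    {β : ℝ} (hint : Integrable fun x => Real.exp (-β * (f x - f xs)) * ψ x) :
    Tendsto (fun α : ℝ => α ^ ((d : ℝ) / 2) * laplaceInt f xs α ψ) atTop
      (𝓝 (gaussConst f xs * ψ xs)) := by
  refine ((hf.laplace_tendsto_of_continuous hψ hint).comp Real.tendsto_sqrt_atTop).congr' ?_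
  filter_upwards [eventually_gt_atTop 0] with α hα
  simp only [Function.comp, Real.sq_sqrt hα.le, laplaceInt]
  congr 1
  rw [Real.sqrt_eq_rpow, ← Real.rpow_natCast, ← Real.rpow_mul hα.le]
  congr 1; ring

theorem Objective.tendsto_normConst {d : ℕ} {f : E d → ℝ} {xs : E d} (hf : Objective f xs) :
    Tendsto (fun α : ℝ => α ^ ((d : ℝ) / 2) * normConst f xs α) atTop
      (𝓝 (gaussConst f xs)) := by
  have := hf.tendsto_laplaceInt_zero (ψ := fun _ => 1) continuous_const (β := 1)
    (by simpa using hf.integrable_exp le_rfl)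
  simpa [laplaceInt, normConst] using this

theorem Objective.tendsto_laplaceInt_one {d : ℕ} {f : E d → ℝ} {xs : E d}
    (hf : Objective f xs) {ψ : E d → ℝ} (hψ : ContDiff ℝ 2 ψ) (h0 : ψ xs = 0)
    {β : ℝ} (hint : Integrable fun x => Real.exp (-β * (f x - f xs)) * ψ x) :
    Tendsto (fun α : ℝ => α ^ ((d : ℝ) / 2 + 1) * laplaceInt f xs α ψ) atTop
      (𝓝 (gaussConst f xs * (laplaceCoeff f xs ψ / 2))) := by
  refine ((hf.laplace_tendsto_of_contDiff hψ h0 hint).comp Real.tendsto_sqrt_atTop).congr' ?_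
  filter_upwards [eventually_gt_atTop 0] with α hα
  simp only [Function.comp, Real.sq_sqrt hα.le, laplaceInt]
  congr 1
  rw [Real.sqrt_eq_rpow, ← Real.rpow_natCast, ← Real.rpow_mul hα.le]
  congr 1; push_cast; ring

theorem laplaceCoeff_sub_const {d : ℕ} (f : E d → ℝ) (xs : E d) (ψ : E d → ℝ) (c : ℝ) :
    laplaceCoeff f xs (fun x => ψ x - c) = laplaceCoeff f xs ψ := by
  have hfd : fderiv ℝ (fun x => ψ x - c) = fderiv ℝ ψ := by
    ext1 x; exact fderiv_sub_const _
  have h1 : grad (fun x => ψ x - c) xs = grad ψ xs := by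
    unfold grad; rw [hfd]
  have h2 : hess (fun x => ψ x - c) xs = hess ψ xs := by
    ext i j; rw [hess_apply, hess_apply, hfd]
  rw [laplaceCoeff, h1, h2, laplaceCoeff]

theorem norm_le_sum_abs {q : ℕ} (y : E q) : ‖y‖ ≤ ∑ i, |y i| := by
  conv_lhs => rw [← sum_smul_bvec y]
  refine (norm_sum_le _ _).trans (Finset.sum_le_sum fun i _ => ?_)
  simp [norm_smul, bvec]

theorem TestFunction.integrable_sub {d q : ℕ} {f : E d → ℝ} {xs : E d} (hf : Objective f xs)
    {φ : E d → E q} (hφ : TestFunction f xs φ) {α : ℝ} (hα : 1 ≤ α) :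
    Integrable fun x => Real.exp (-α * (f x - f xs)) • (φ x - φ xs) := by
  have hc := hf.smooth.continuous
  have hφc := hφ.smooth.continuous
  refine integrable_exp_mul_of_le hf (hφc.sub continuous_const).aestronglyMeasurable hα ?_
  have h1 : Integrable fun x => Real.exp (-1 * (f x - f xs)) • φ x := by
    refine (hφ.integrable.const_mul (Real.exp (f xs))).mono
      (Continuous.aestronglyMeasurable (by fun_prop)) (ae_of_all _ fun x => ?_)
    rw [norm_smul, norm_mul, norm_mul, norm_norm, Real.norm_of_nonneg (Real.exp_nonneg _),
      Real.norm_of_nonneg (Real.exp_nonneg _), Real.norm_of_nonneg (Real.exp_nonneg _),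
      ← mul_assoc, ← Real.exp_add]
    apply le_of_eq
    congr 2; ring
  have h2 := (hf.integrable_exp le_rfl).smul_const (φ xs)
  refine (h1.sub h2).congr (ae_of_all _ fun x => ?_)
  simp [smul_sub]

/-- The bias `π_α(φ) - φ(x⋆)`. -/
noncomputable def bias {d q : ℕ} (f : E d → ℝ) (xs : E d) (φ : E d → E q) (α : ℝ) : E q :=
  (normConst f xs α)⁻¹ • ∫ x, Real.exp (-α * (f x - f xs)) • (φ x - φ xs)

theorem TestFunction.exists_bias_bound {d q : ℕ} {f : E d → ℝ} {xs : E d} (hf : Objective f xs)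
    {φ : E d → E q} (hφ : TestFunction f xs φ) :
    ∃ αt > (1 : ℝ), ∀ α > αt, 9 / 4 * ‖bias f xs φ α‖ ^ 2 ≤ CL f xs φ ^ 2 / α ^ 2 := by
  have hG := hf.gaussConst_pos
  have hcoord : ∀ α : ℝ, 1 ≤ α → ∀ i, bias f xs φ α i =
      (normConst f xs α)⁻¹ * laplaceInt f xs α (fun x => φ x i - φ xs i) := by
    intro α hα i
    have := (EuclideanSpace.proj (𝕜 := ℝ) i : E q →L[ℝ] ℝ).integral_comp_comm
      (hφ.integrable_sub hf hα)
    simp only [PiLp.proj_apply, PiLp.smul_apply, PiLp.sub_apply, smul_eq_mul] at this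
    rw [bias, PiLp.smul_apply, smul_eq_mul, laplaceInt, this]
  have hlim : ∀ i : Fin q, Tendsto (fun α : ℝ => α * |(normConst f xs α)⁻¹ *
      laplaceInt f xs α (fun x => φ x i - φ xs i)|) atTop
      (𝓝 (CLs f xs (fun y => φ y i) / 2)) := by
    intro i
    have hsm : ContDiff ℝ 2 fun x => φ x i - φ xs i := by
      have := hφ.smooth
      exact (contDiff_euclidean.1 this i).sub contDiff_const
    have hint : Integrable fun x => Real.exp (-1 * (f x - f xs)) * (φ x i - φ xs i) := by
      have := (EuclideanSpace.proj (𝕜 := ℝ) i : E q →L[ℝ] ℝ).integrable_comp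
        (hφ.integrable_sub hf le_rfl)
      simpa using this
    have h1 := (hf.tendsto_laplaceInt_one hsm (by simp) hint).div hf.tendsto_normConst hG.ne'
    have h2 := h1.abs
    rw [mul_div_cancel_left₀ _ hG.ne', laplaceCoeff_sub_const, abs_div, abs_two] at h2
    refine h2.congr' ?_
    filter_upwards [eventually_gt_atTop 0, eventually_ge_atTop 1] with α hα hα1
    have hZ := hf.normConst_pos hα1
    conv_rhs => rw [← abs_of_pos hα, ← abs_mul, abs_of_pos hα]
    congr 1
    simp only [Pi.div_apply]
    rw [Real.rpow_add hα, Real.rpow_one]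
    have : 0 < α ^ ((d : ℝ) / 2) := Real.rpow_pos_of_pos hα _
    field_simp
  have hsum := tendsto_finsetSum Finset.univ fun i _ => hlim i
  have hlt : ∑ i, CLs f xs (fun y => φ y i) / 2 < 2 / 3 * CL f xs φ := by
    rw [← Finset.sum_div]
    have := hφ.coeff_pos
    unfold CL at *
    linarith
  obtain ⟨a, ha⟩ := eventually_atTop.1 (hsum.eventually (eventually_lt_nhds hlt))
  refine ⟨max a 2, lt_max_of_lt_right one_lt_two, fun α hα => ?_⟩
  have hα2 : 2 < α := (le_max_right _ _).trans_lt hα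
  have h1 := ha α ((le_max_left _ _).trans hα.le)
  have h2 : α * ‖bias f xs φ α‖ ≤ 2 / 3 * CL f xs φ := by
    refine le_trans ?_ h1.le
    rw [← Finset.mul_sum]
    gcongr
    refine (norm_le_sum_abs _).trans (Finset.sum_le_sum fun i _ => ?_)
    rw [hcoord α (by linarith)]
  rw [le_div_iff₀ (by positivity)]
  have h3 : (α * ‖bias f xs φ α‖) ^ 2 ≤ (2 / 3 * CL f xs φ) ^ 2 := by gcongr
  nlinarith

/-- `∫ exp(-2α (f - f(x⋆))) ψ / (∫ exp(-α (f - f(x⋆))))²`. -/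
noncomputable def secondMoment {d : ℕ} (f : E d → ℝ) (xs : E d) (α : ℝ) (ψ : E d → ℝ) : ℝ :=
  laplaceInt f xs (2 * α) ψ / normConst f xs α ^ 2

theorem secondMoment_le {d : ℕ} {f : E d → ℝ} {xs : E d} (hf : Objective f xs) {ψ : E d → ℝ}
    (hψ : Continuous ψ) (h0 : ∀ x, 0 ≤ ψ x)
    (hint : Integrable fun x => Real.exp (-2 * (f x - f xs)) * ψ x) {a α : ℝ} (hα : 1 ≤ α)
    (ha : α ≤ a) :
    secondMoment f xs α ψ ≤ laplaceInt f xs 2 ψ / normConst f xs a ^ 2 := by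
  have hZ := hf.normConst_pos (hα.trans ha)
  have hZ' := hf.normConst_anti hα ha
  have h2 : 0 ≤ laplaceInt f xs 2 ψ :=
    integral_nonneg fun x => mul_nonneg (Real.exp_nonneg _) (h0 x)
  have hJ : laplaceInt f xs (2 * α) ψ ≤ laplaceInt f xs 2 ψ := by
    refine integral_mono
      (integrable_exp_mul_of_le (a := 2) hf hψ.aestronglyMeasurable (by linarith) hint) hint
      fun x => ?_
    simp only
    have := hf.sub_nonneg x
    have h3 := h0 x
    gcongr
    nlinarith
  unfold secondMoment
  gcongr

theorem exists_le_mul_one_add_div {r : ℝ → ℝ} {L U : ℝ} (hr : Tendsto r atTop (𝓝 L)) (hLU : L < U)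
    (hU : 0 < U) (hb : ∀ a, ∃ B, ∀ α, 1 ≤ α → α ≤ a → r α ≤ B) :
    ∃ C > 0, ∀ α, 1 ≤ α → r α ≤ U * (1 + C / α) := by
  obtain ⟨a, ha⟩ := eventually_atTop.1 (hr.eventually (eventually_lt_nhds hLU))
  obtain ⟨B, hB⟩ := hb a
  refine ⟨(|B| / U + 1) * (|a| + 1), by positivity, fun α hα => ?_⟩
  have hα0 : 0 < α := by linarith
  rcases le_total a α with h | h
  · refine (ha α h).le.trans ?_
    have : 0 ≤ (|B| / U + 1) * (|a| + 1) / α := by positivity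
    nlinarith
  · refine (hB α hα h).trans ((le_abs_self B).trans ?_)
    have h1 : 1 ≤ (|a| + 1) / α := by
      rw [le_div_iff₀ hα0]; linarith [le_abs_self a]
    have h2 : |B| / U ≤ (|B| / U + 1) * (|a| + 1) / α := by
      rw [mul_div_assoc]
      have : 0 ≤ |B| / U := by positivity
      nlinarith
    calc |B| = U * (|B| / U) := by field_simp
      _ ≤ U * (1 + (|B| / U + 1) * (|a| + 1) / α) := by gcongr; linarith

theorem exists_secondMoment_le {d : ℕ} {f : E d → ℝ} {xs : E d} (hf : Objective f xs)
    {ψ : E d → ℝ} (hψ : Continuous ψ) (h0 : ∀ x, 0 ≤ ψ x)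
    (hint : Integrable fun x => Real.exp (-2 * (f x - f xs)) * ψ x) :
    ∃ K > 0, ∀ α, 1 ≤ α → secondMoment f xs α ψ ≤ K * α ^ ((d : ℝ) / 2) := by
  have hG := hf.gaussConst_pos
  have h1 := ((hf.tendsto_laplaceInt_zero hψ hint).comp
    (tendsto_id.const_mul_atTop (two_pos (α := ℝ)))).div (hf.tendsto_normConst.pow 2)
    (by positivity)
  have h2 := h1.const_mul ((2 : ℝ) ^ (-((d : ℝ) / 2)))
  have h3 : Tendsto (fun α : ℝ => secondMoment f xs α ψ * α ^ (-((d : ℝ) / 2))) atTop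
      (𝓝 ((2 : ℝ) ^ (-((d : ℝ) / 2)) * (gaussConst f xs * ψ xs / gaussConst f xs ^ 2))) := by
    refine h2.congr' ?_
    filter_upwards [eventually_gt_atTop 0, eventually_ge_atTop 1] with α hα hα1
    have hZ := hf.normConst_pos hα1
    simp only [Pi.div_apply, Function.comp, id, secondMoment]
    rw [Real.mul_rpow (by norm_num) hα.le, Real.rpow_neg (by norm_num), Real.rpow_neg hα.le]
    have : 0 < α ^ ((d : ℝ) / 2) := Real.rpow_pos_of_pos hα _
    have : 0 < (2 : ℝ) ^ ((d : ℝ) / 2) := Real.rpow_pos_of_pos two_pos _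
    field_simp
  obtain ⟨C, hC, hle⟩ := exists_le_mul_one_add_div h3 (U := _ + 1) (lt_add_one _)
    (by have := h0 xs; positivity) fun a => ⟨laplaceInt f xs 2 ψ / normConst f xs a ^ 2,
      fun α hα ha => by
        have hα0 : 0 < α := by linarith
        refine le_trans ?_ (secondMoment_le hf hψ h0 hint hα ha)
        have hs : 0 ≤ secondMoment f xs α ψ := div_nonneg
          (integral_nonneg fun x => mul_nonneg (Real.exp_nonneg _) (h0 x)) (by positivity)
        refine mul_le_of_le_one_right hs ?_
        exact Real.rpow_le_one_of_one_le_of_nonpos hα (by simp; positivity)⟩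
  refine ⟨((2 : ℝ) ^ (-((d : ℝ) / 2)) * (gaussConst f xs * ψ xs / gaussConst f xs ^ 2) + 1) *
    (1 + C), by have := h0 xs; positivity, fun α hα => ?_⟩
  have hα0 : 0 < α := by linarith
  have h4 := hle α hα
  have hp : 0 < α ^ ((d : ℝ) / 2) := Real.rpow_pos_of_pos hα0 _
  rw [Real.rpow_neg hα0.le, ← div_eq_mul_inv, div_le_iff₀ hp] at h4
  refine h4.trans ?_
  have := h0 xs
  gcongr
  exact div_le_self hC.le hα

theorem exists_secondMoment_le_of_eq_zero {d : ℕ} {f : E d → ℝ} {xs : E d} (hf : Objective f xs)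
    {ψ : E d → ℝ} (hψ : ContDiff ℝ 2 ψ) (h0 : ∀ x, 0 ≤ ψ x) (hxs : ψ xs = 0)
    (hpos : 0 < CLs f xs ψ)
    (hint : Integrable fun x => Real.exp (-2 * (f x - f xs)) * ψ x) :
    ∃ C > 0, ∀ α, 1 ≤ α → 9 / 4 * secondMoment f xs α ψ ≤
      9 * mconst f xs α * (2 : ℝ) ^ (-(d : ℝ) / 2) * (CLs f xs ψ / (2 * α)) * (1 + C / α) := by
  have hG := hf.gaussConst_pos
  have h1 := ((hf.tendsto_laplaceInt_one hψ hxs hint).comp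
    (tendsto_id.const_mul_atTop (two_pos (α := ℝ)))).div (hf.tendsto_normConst.pow 2)
    (by positivity)
  have h2 := h1.const_mul (9 / 8 * (2 : ℝ) ^ (-(d : ℝ) / 2))
  have h22 : 0 < (2 : ℝ) ^ ((d : ℝ) / 2) := Real.rpow_pos_of_pos two_pos _
  have h3 : Tendsto (fun α : ℝ => 9 / 4 * secondMoment f xs α ψ * α / α ^ ((d : ℝ) / 2)) atTop
      (𝓝 (9 / 8 * (2 : ℝ) ^ (-(d : ℝ) / 2) *
        (gaussConst f xs * (laplaceCoeff f xs ψ / 2) / gaussConst f xs ^ 2))) := by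
    refine h2.congr' ?_
    filter_upwards [eventually_gt_atTop 0, eventually_ge_atTop 1] with α hα hα1
    have hZ := hf.normConst_pos hα1
    simp only [Pi.div_apply, Function.comp, id, secondMoment]
    rw [Real.mul_rpow (by norm_num) hα.le, neg_div, Real.rpow_neg (by norm_num),
      Real.rpow_add hα, Real.rpow_add two_pos, Real.rpow_one, Real.rpow_one]
    have : 0 < α ^ ((d : ℝ) / 2) := Real.rpow_pos_of_pos hα _
    field_simp
    ring
  have hle : laplaceCoeff f xs ψ ≤ CLs f xs ψ := le_abs_self _
  have h2p : 0 < (2 : ℝ) ^ (-(d : ℝ) / 2) := Real.rpow_pos_of_pos two_pos _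
  obtain ⟨C, hC, hb⟩ := exists_le_mul_one_add_div h3
    (U := 9 / 2 * (2 : ℝ) ^ (-(d : ℝ) / 2) * CLs f xs ψ / gaussConst f xs) (by
      have e : 9 / 8 * (2 : ℝ) ^ (-(d : ℝ) / 2) *
          (gaussConst f xs * (laplaceCoeff f xs ψ / 2) / gaussConst f xs ^ 2) =
          9 / 16 * (2 : ℝ) ^ (-(d : ℝ) / 2) * laplaceCoeff f xs ψ / gaussConst f xs := by
        field_simp; ring
      rw [e]
      gcongr ?_ / _
      have : (2 : ℝ) ^ (-(d : ℝ) / 2) * laplaceCoeff f xs ψ ≤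
        (2 : ℝ) ^ (-(d : ℝ) / 2) * CLs f xs ψ := by gcongr
      have : 0 < (2 : ℝ) ^ (-(d : ℝ) / 2) * CLs f xs ψ := by positivity
      linarith) (by positivity) fun a => ⟨9 / 4 * (laplaceInt f xs 2 ψ / normConst f xs a ^ 2) * a,
      fun α hα ha => by
        have hα0 : 0 < α := by linarith
        have hs : 0 ≤ secondMoment f xs α ψ := div_nonneg
          (integral_nonneg fun x => mul_nonneg (Real.exp_nonneg _) (h0 x)) (by positivity)
        refine (div_le_self (by positivity) (Real.one_le_rpow hα (by positivity))).trans ?_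
        have := secondMoment_le hf hψ.continuous h0 hint hα ha
        gcongr
        exact mul_nonneg (by norm_num) (hs.trans this)⟩
  refine ⟨C, hC, fun α hα => ?_⟩
  have hα0 : 0 < α := by linarith
  have hp : 0 < α ^ ((d : ℝ) / 2) := Real.rpow_pos_of_pos hα0 _
  have h4 := hb α hα
  rw [div_le_iff₀ hp, ← le_div_iff₀ hα0] at h4
  refine h4.trans (le_of_eq ?_)
  rw [hf.mconst_eq hα0.le]
  field_simp

theorem Envelope.integrable_inv {d q : ℕ} {f : E d → ℝ} {xs : E d} (hf : Objective f xs)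
    {φ : E d → E q} {g₀ : E d → ℝ} (hg : Envelope f xs φ g₀) :
    Integrable fun x => Real.exp (-2 * (f x - f xs)) * (1 / g₀ x) := by
  obtain ⟨c₀, hc₀, hle⟩ := hg.tail
  have hc := hf.smooth.continuous
  have hgc := hg.smooth_inv.continuous
  refine ((hf.integrable_exp le_rfl).const_mul c₀).mono'
    (Continuous.aestronglyMeasurable (by fun_prop)) (ae_of_all _ fun x => ?_)
  have hgx := hg.pos x
  rw [Real.norm_of_nonneg (by positivity), mul_one_div, div_le_iff₀ hgx]
  have h1 := hle x
  have e1 : Real.exp (-2 * (f x - f xs)) =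
      Real.exp (-1 * (f x - f xs)) * Real.exp (-(f x - f xs)) := by
    rw [← Real.exp_add]; congr 1; ring
  rw [e1]
  have := Real.exp_pos (-1 * (f x - f xs))
  nlinarith

theorem Envelope.integrable_bar_sq {d q : ℕ} {f : E d → ℝ} {xs : E d} (hf : Objective f xs)
    {φ : E d → E q} {g₀ : E d → ℝ} (hg : Envelope f xs φ g₀) :
    Integrable fun x => Real.exp (-2 * (f x - f xs)) * (‖φ x - φ xs‖ ^ 2 / g₀ x) := by
  obtain ⟨c₀, hc₀, hle⟩ := hg.tail
  have hc := hf.smooth.continuous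
  have hgc := hg.smooth_bar_sq.continuous
  have hi := ((hg.integrable_sq.const_mul 2).add
    ((hf.integrable_exp le_rfl).const_mul (2 * ‖φ xs‖ ^ 2))).const_mul c₀
  refine hi.mono' (Continuous.aestronglyMeasurable (by fun_prop)) (ae_of_all _ fun x => ?_)
  have hgx := hg.pos x
  rw [Real.norm_of_nonneg (by positivity), mul_div_assoc', div_le_iff₀ hgx]
  have h1 := hle x
  have e1 : Real.exp (-2 * (f x - f xs)) =
      Real.exp (-1 * (f x - f xs)) * Real.exp (-(f x - f xs)) := by
    rw [← Real.exp_add]; congr 1; ring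
  have e2 : Real.exp (-(f x - f xs)) = Real.exp (-1 * (f x - f xs)) := by congr 1; ring
  have h3 : ‖φ x - φ xs‖ ^ 2 ≤ 2 * ‖φ x‖ ^ 2 + 2 * ‖φ xs‖ ^ 2 := by
    have := norm_sub_le (φ x) (φ xs)
    have h4 : ‖φ x - φ xs‖ ^ 2 ≤ (‖φ x‖ + ‖φ xs‖) ^ 2 := by gcongr
    nlinarith [sq_nonneg (‖φ x‖ - ‖φ xs‖)]
  have hp := Real.exp_pos (-1 * (f x - f xs))
  calc Real.exp (-2 * (f x - f xs)) * ‖φ x - φ xs‖ ^ 2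
      ≤ (Real.exp (-1 * (f x - f xs)) * (c₀ * g₀ x)) * (2 * ‖φ x‖ ^ 2 + 2 * ‖φ xs‖ ^ 2) := by
        rw [e1]; gcongr
    _ = _ := by simp only [Pi.add_apply, e2]; ring

open scoped ENNReal

theorem lintegral_comp_pair_eq {A V Ω : Type*} [MeasurableSpace A] [MeasurableSpace V]
    [MeasurableSpace Ω] {P : Measure Ω} [IsProbabilityMeasure P] {vol : Measure V} [SFinite vol]
    {Y : Ω → A} (hY : Measurable Y) {X : Ω → V} (hX : Measurable X) {p : A → V → ℝ}
    (hp : Measurable (Function.uncurry p))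
    (h : ∀ s, MeasurableSet s → ∀ t, MeasurableSet t → P (Y ⁻¹' s ∩ X ⁻¹' t) =
      ∫⁻ ω in Y ⁻¹' s, ∫⁻ x in t, ENNReal.ofReal (p (Y ω) x) ∂vol ∂P)
    {k : A → V → ℝ≥0∞} (hk : Measurable (Function.uncurry k)) :
    ∫⁻ ω, k (Y ω) (X ω) ∂P =
      ∫⁻ ω, ∫⁻ x, k (Y ω) x * ENNReal.ofReal (p (Y ω) x) ∂vol ∂P := by
  have hYX : Measurable fun ω => (Y ω, X ω) := hY.prodMk hX
  set μ₁ := P.map fun ω => (Y ω, X ω) with hμ₁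
  have hpm : Measurable fun z : A × V => ENNReal.ofReal (Function.uncurry p z) := hp.ennreal_ofReal
  set μ₂ := ((P.map Y).prod vol).withDensity fun z => ENNReal.ofReal (Function.uncurry p z) with hμ₂
  have : IsProbabilityMeasure μ₁ := Measure.isProbabilityMeasure_map hYX.aemeasurable
  have hrect : ∀ s, MeasurableSet s → ∀ t, MeasurableSet t → μ₁ (s ×ˢ t) = μ₂ (s ×ˢ t) := by
    intro s hs t ht
    rw [hμ₁, Measure.map_apply hYX (hs.prod ht), hμ₂, withDensity_apply _ (hs.prod ht),
      ← Measure.prod_restrict, lintegral_prod _ hpm.aemeasurable,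
      Measure.restrict_map hY hs, lintegral_map (hpm.lintegral_prod_right') hY]
    exact h s hs t ht
  have heq : μ₁ = μ₂ := by
    refine ext_of_generate_finite _ generateFrom_prod.symm isPiSystem_prod ?_ ?_
    · rintro _ ⟨s, hs, t, ht, rfl⟩
      exact hrect s hs t ht
    · rw [← Set.univ_prod_univ]
      exact hrect _ MeasurableSet.univ _ MeasurableSet.univ
  have h1 : ∫⁻ ω, k (Y ω) (X ω) ∂P = ∫⁻ z, Function.uncurry k z ∂μ₁ := by
    rw [hμ₁, lintegral_map hk hYX]; rfl
  rw [h1, heq, hμ₂, lintegral_withDensity_eq_lintegral_mul _ hpm hk,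
    lintegral_prod _ (hpm.mul hk).aemeasurable,
    lintegral_map ((hpm.mul hk).lintegral_prod_right') hY]
  refine lintegral_congr fun ω => lintegral_congr fun x => ?_
  simp [mul_comm]

/-- The information available before drawing `X^{i+1}`; trivial for `i = 0`. -/
abbrev past {Ω : Type*} {mΩ : MeasurableSpace Ω} (F : Filtration ℕ mΩ) (i : ℕ) : MeasurableSpace Ω :=
  if i = 0 then ⊥ else F i

theorem past_le {Ω : Type*} {mΩ : MeasurableSpace Ω} (F : Filtration ℕ mΩ) (i : ℕ) :
    past F i ≤ mΩ := by
  unfold past; split_ifs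
  · exact bot_le
  · exact F.le i

theorem past_mono {Ω : Type*} {mΩ : MeasurableSpace Ω} (F : Filtration ℕ mΩ) {i j : ℕ}
    (h : i ≤ j) : past F i ≤ past F j := by
  unfold past
  split_ifs with h1 h2
  · exact le_rfl
  · exact bot_le
  · omega
  · exact F.mono h

section Sampling

variable {d q : ℕ} {Ω : Type*} {mΩ : MeasurableSpace Ω} {P : Measure Ω}
  {F : Filtration ℕ mΩ} {𝒬 : Set (E d → ℝ)} {X : ℕ → Ω → E d} {p : ℕ → Ω → E d → ℝ}

theorem IsDensity.setLIntegral_eq {p₀ : E d → ℝ} (h : IsDensity p₀) (t : Set (E d)) :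
    ∫⁻ x in t, ENNReal.ofReal (p₀ x) = ENNReal.ofReal (∫ x in t, p₀ x) :=
  (ofReal_integral_eq_lintegral_ofReal h.integrable.integrableOn (ae_of_all _ h.nonneg)).symm

theorem AdaptiveSampling.measurable_past (h : AdaptiveSampling P F 𝒬 X p)
    (hQ : ∀ p₀ ∈ 𝒬, IsDensity p₀) (i : ℕ) :
    Measurable[(past F i).prod inferInstance] (Function.uncurry (p i)) := by
  rcases Nat.eq_zero_or_pos i with rfl | hi
  · obtain ⟨q₀, hq₀, hp, -⟩ := h.init
    have : Function.uncurry (p 0) = fun z : Ω × E d => q₀ z.2 := by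
      ext z; simp [Function.uncurry, hp]
    rw [this]
    refine (hQ q₀ hq₀).measurable.comp ?_
    exact @measurable_snd Ω (E d) (past F 0) _
  · have := h.measurable_density i hi
    rwa [past, if_neg hi.ne']

theorem AdaptiveSampling.ae_mem (h : AdaptiveSampling P F 𝒬 X p) :
    ∀ᵐ ω ∂P, ∀ i, p i ω ∈ 𝒬 := by
  rw [ae_all_iff]
  intro i
  rcases Nat.eq_zero_or_pos i with rfl | hi
  · obtain ⟨q₀, hq₀, hp, -⟩ := h.init
    exact ae_of_all _ fun ω => by rw [hp]; exact hq₀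
  · exact h.mem i hi

theorem AdaptiveSampling.measurable_next (h : AdaptiveSampling P F 𝒬 X p) (i : ℕ) :
    Measurable (X (i + 1)) :=
  (h.adapted i).mono (F.le _) le_rfl

theorem AdaptiveSampling.measure_inter_eq [IsProbabilityMeasure P] (h : AdaptiveSampling P F 𝒬 X p)
    (hQ : ∀ p₀ ∈ 𝒬, IsDensity p₀) (i : ℕ) {s : Set Ω} (hs : MeasurableSet[past F i] s)
    {t : Set (E d)} (ht : MeasurableSet t) :
    P (s ∩ X (i + 1) ⁻¹' t) = ∫⁻ ω in s, (∫⁻ x in t, ENNReal.ofReal (p i ω x)) ∂P := by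
  rcases Nat.eq_zero_or_pos i with rfl | hi
  · obtain ⟨q₀, hq₀, hp, hmap⟩ := h.init
    have hs' : s = ∅ ∨ s = Set.univ := by
      rw [past, if_pos rfl] at hs
      exact MeasurableSpace.measurableSet_bot_iff.1 hs
    rcases hs' with rfl | rfl
    · simp
    · rw [Set.univ_inter, ← Measure.map_apply (h.measurable_next 0) ht, hmap,
        withDensity_apply _ ht]
      simp [hp]
  · rw [past, if_neg hi.ne'] at hs
    have hs0 : MeasurableSet s := F.le i s hs
    have hXt : MeasurableSet (X (i + 1) ⁻¹' t) := h.measurable_next i ht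
    have hint : Integrable ((X (i + 1) ⁻¹' t).indicator fun _ => (1 : ℝ)) P :=
      (integrable_const _).indicator hXt
    have h1 := setIntegral_condExp (F.le i) hint hs
    have h2 := h.cond_law i hi t ht
    have h3 : ∫ ω in s, P[(X (i + 1) ⁻¹' t).indicator (fun _ => (1 : ℝ)) | F i] ω ∂P =
        ∫ ω in s, (∫ x in t, p i ω x) ∂P := integral_congr_ae (ae_restrict_of_ae h2)
    have hint2 : Integrable (fun ω => ∫ x in t, p i ω x) P :=
      integrable_condExp.congr h2
    have h4 : ∫⁻ ω in s, (∫⁻ x in t, ENNReal.ofReal (p i ω x)) ∂P =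
        ENNReal.ofReal (∫ ω in s, (∫ x in t, p i ω x) ∂P) := by
      rw [ofReal_integral_eq_lintegral_ofReal hint2.integrableOn]
      · refine lintegral_congr_ae (ae_restrict_of_ae ?_)
        filter_upwards [h.ae_mem] with ω hω
        exact (hQ _ (hω i)).setLIntegral_eq t
      · refine ae_restrict_of_ae ?_
        filter_upwards [h.ae_mem] with ω hω
        exact integral_nonneg (hQ _ (hω i)).nonneg
    rw [h4, ← h3, h1, integral_indicator hXt, Measure.restrict_restrict hXt, setIntegral_const,
      smul_eq_mul, mul_one, measureReal_def, ENNReal.ofReal_toReal (measure_ne_top _ _),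
      Set.inter_comm]

/-- Integration against the conditional law of the next sample. -/
theorem AdaptiveSampling.lintegral_next [IsProbabilityMeasure P]
    (h : AdaptiveSampling P F 𝒬 X p)
    (hQ : ∀ p₀ ∈ 𝒬, IsDensity p₀) (i : ℕ) {k : Ω → E d → ℝ≥0∞}
    (hk : Measurable[(past F i).prod inferInstance] (Function.uncurry k)) :
    ∫⁻ ω, k ω (X (i + 1) ω) ∂P = ∫⁻ ω, (∫⁻ x, k ω x * ENNReal.ofReal (p i ω x)) ∂P :=
  @lintegral_comp_pair_eq Ω (E d) Ω (past F i) _ mΩ P _ volume _ id (measurable_id'' (past_le F i))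
    (X (i + 1)) (h.measurable_next i) (p i) (h.measurable_past hQ i)
    (fun _ hs _ ht => h.measure_inter_eq hQ i hs ht) k hk

end Sampling

theorem exp_neg_le_quadratic {x : ℝ} (hx : 0 ≤ x) : Real.exp (-x) ≤ 1 - x + x ^ 2 / 2 := by
  have h1 := Real.quadratic_le_exp_of_nonneg hx
  rw [Real.exp_neg, inv_le_iff_one_le_mul₀ (Real.exp_pos x)]
  have h2 : 0 ≤ 1 - x + x ^ 2 / 2 := by nlinarith [sq_nonneg (x - 1)]
  calc (1 : ℝ) ≤ (1 - x + x ^ 2 / 2) * (1 + x + x ^ 2 / 2) := by nlinarith [sq_nonneg (x ^ 2)]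
    _ ≤ _ := by gcongr

section Density

variable {d q : ℕ} {f : E d → ℝ} {xs : E d} {φ : E d → E q} {g₀ p₀ : E d → ℝ}

theorem lintegral_norm_add_sq_le (hf : Objective f xs) (hφ : TestFunction f xs φ)
    (hg : Envelope f xs φ g₀) (hp : IsDensity p₀) (hgp : ∀ x, g₀ x ≤ p₀ x) {α : ℝ} (hα : 1 ≤ α)
    (s : E q) :
    ∫⁻ x, ENNReal.ofReal (‖s + ((Real.exp (-α * (f x - f xs)) / (p₀ x * normConst f xs α)) •
        (φ x - φ xs) - bias f xs φ α)‖ ^ 2) * ENNReal.ofReal (p₀ x) ≤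
      ENNReal.ofReal (‖s‖ ^ 2 + secondMoment f xs α fun x => ‖φ x - φ xs‖ ^ 2 / g₀ x) := by
  set m := bias f xs φ α with hm
  set Z := normConst f xs α with hZdef
  have hZ : 0 < Z := hf.normConst_pos hα
  have i1 := (hp.integrable).const_mul (‖s - m‖ ^ 2)
  have hb := hφ.integrable_sub hf hα
  have i2 := ((innerSL ℝ (s - m)).integrable_comp hb).const_mul (2 / Z)
  have i3 := (integrable_exp_mul_of_le (a := 2) (b := 2 * α) hf
    hg.smooth_bar_sq.continuous.aestronglyMeasurable (by linarith)
    (hg.integrable_bar_sq hf)).const_mul (Z ^ 2)⁻¹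
  have iG := (i1.add i2).add i3
  have hle : ∀ x, ‖s + ((Real.exp (-α * (f x - f xs)) / (p₀ x * Z)) •
        (φ x - φ xs) - m)‖ ^ 2 * p₀ x ≤ ‖s - m‖ ^ 2 * p₀ x +
        2 / Z * innerSL ℝ (s - m) (Real.exp (-α * (f x - f xs)) • (φ x - φ xs)) +
        (Z ^ 2)⁻¹ * (Real.exp (-(2 * α) * (f x - f xs)) • (‖φ x - φ xs‖ ^ 2 / g₀ x)) := by
    intro x
    have hg0 := hg.pos x
    have hp0 : 0 < p₀ x := hg0.trans_le (hgp x)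
    set e := Real.exp (-α * (f x - f xs)) with he
    have he2 : Real.exp (-(2 * α) * (f x - f xs)) = e ^ 2 := by
      rw [he, ← Real.exp_nat_mul]; congr 1; push_cast; ring
    rw [show s + ((e / (p₀ x * Z)) • (φ x - φ xs) - m) =
      (s - m) + (e / (p₀ x * Z)) • (φ x - φ xs) by abel, norm_add_sq_real, norm_smul,
      inner_smul_right, innerSL_apply_apply, inner_smul_right, he2, smul_eq_mul, mul_pow,
      Real.norm_of_nonneg (by positivity)]
    have h3 : (e / (p₀ x * Z)) ^ 2 * ‖φ x - φ xs‖ ^ 2 * p₀ x =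
        (Z ^ 2)⁻¹ * (e ^ 2 * (‖φ x - φ xs‖ ^ 2 / p₀ x)) := by field_simp
    have h4 : (Z ^ 2)⁻¹ * (e ^ 2 * (‖φ x - φ xs‖ ^ 2 / p₀ x)) ≤
        (Z ^ 2)⁻¹ * (e ^ 2 * (‖φ x - φ xs‖ ^ 2 / g₀ x)) := by
      have := hgp x
      gcongr
    have h5 : 2 * (e / (p₀ x * Z) * inner ℝ (s - m) (φ x - φ xs)) * p₀ x =
        2 / Z * (e * inner ℝ (s - m) (φ x - φ xs)) := by field_simp
    nlinarith
  calc _ = ∫⁻ x, ENNReal.ofReal (‖s + ((Real.exp (-α * (f x - f xs)) / (p₀ x * Z)) •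
        (φ x - φ xs) - m)‖ ^ 2 * p₀ x) :=
        lintegral_congr fun x => (ENNReal.ofReal_mul (by positivity)).symm
    _ ≤ _ := lintegral_mono fun x => ENNReal.ofReal_le_ofReal (hle x)
    _ = _ := (ofReal_integral_eq_lintegral_ofReal iG (ae_of_all _ fun x =>
        (mul_nonneg (by positivity) (hp.nonneg x)).trans (hle x))).symm
    _ ≤ _ := by
        refine ENNReal.ofReal_le_ofReal ?_
        have e0 : ∫ x, (‖s - m‖ ^ 2 * p₀ x +
            2 / Z * innerSL ℝ (s - m) (Real.exp (-α * (f x - f xs)) • (φ x - φ xs)) +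
            (Z ^ 2)⁻¹ * (Real.exp (-(2 * α) * (f x - f xs)) • (‖φ x - φ xs‖ ^ 2 / g₀ x))) =
            ‖s - m‖ ^ 2 + 2 * inner ℝ (s - m) m +
              secondMoment f xs α fun x => ‖φ x - φ xs‖ ^ 2 / g₀ x := by
          rw [integral_add (i1.fun_add i2) i3, integral_add i1 i2, integral_const_mul,
            integral_const_mul, integral_const_mul, hp.integral_eq_one, mul_one,
            ContinuousLinearMap.integral_comp_comm _ hb, innerSL_apply_apply]
          congr 1
          · rw [hm, bias, inner_smul_right, ← hZdef]; ring
          · rw [secondMoment, laplaceInt, ← hZdef, inv_mul_eq_div]; rfl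
        refine le_trans (le_of_eq e0) ?_
        have : ‖s‖ ^ 2 = ‖s - m‖ ^ 2 + 2 * inner ℝ (s - m) m + ‖m‖ ^ 2 := by
          rw [← norm_add_sq_real, sub_add_cancel]
        nlinarith [sq_nonneg ‖m‖]

theorem lintegral_exp_neg_le (hf : Objective f xs)
    (hg : Envelope f xs φ g₀) (hp : IsDensity p₀) (hgp : ∀ x, g₀ x ≤ p₀ x) {α : ℝ} (hα : 1 ≤ α)
    {l : ℝ} (hl : 0 ≤ l) :
    ∫⁻ x, ENNReal.ofReal (Real.exp (-l *
        (Real.exp (-α * (f x - f xs)) / (p₀ x * normConst f xs α)))) * ENNReal.ofReal (p₀ x) ≤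
      ENNReal.ofReal (Real.exp (-l + l ^ 2 / 2 * secondMoment f xs α fun x => 1 / g₀ x)) := by
  set Z := normConst f xs α with hZdef
  have hZ : 0 < Z := hf.normConst_pos hα
  have i1 := hp.integrable
  have i2 := (hf.integrable_exp hα).const_mul (l / Z)
  have i3 := (integrable_exp_mul_of_le (a := 2) (b := 2 * α) hf
    hg.smooth_inv.continuous.aestronglyMeasurable (by linarith)
    (hg.integrable_inv hf)).const_mul (l ^ 2 / 2 * (Z ^ 2)⁻¹)
  have iG := (i1.sub i2).add i3
  have hle : ∀ x, Real.exp (-l * (Real.exp (-α * (f x - f xs)) / (p₀ x * Z))) * p₀ x ≤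
      p₀ x - l / Z * Real.exp (-α * (f x - f xs)) +
        l ^ 2 / 2 * (Z ^ 2)⁻¹ * (Real.exp (-(2 * α) * (f x - f xs)) • (1 / g₀ x)) := by
    intro x
    have hg0 := hg.pos x
    have hp0 : 0 < p₀ x := hg0.trans_le (hgp x)
    set e := Real.exp (-α * (f x - f xs)) with he
    have he0 : 0 < e := Real.exp_pos _
    have he2 : Real.exp (-(2 * α) * (f x - f xs)) = e ^ 2 := by
      rw [he, ← Real.exp_nat_mul]; congr 1; push_cast; ring
    have h1 := exp_neg_le_quadratic (x := l * (e / (p₀ x * Z))) (by positivity)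
    rw [neg_mul, he2, smul_eq_mul]
    calc Real.exp (-(l * (e / (p₀ x * Z)))) * p₀ x
        ≤ (1 - l * (e / (p₀ x * Z)) + (l * (e / (p₀ x * Z))) ^ 2 / 2) * p₀ x := by gcongr
      _ = p₀ x - l / Z * e + l ^ 2 / 2 * (Z ^ 2)⁻¹ * (e ^ 2 * (1 / p₀ x)) := by field_simp
      _ ≤ _ := by
        have := hgp x
        gcongr
  calc _ = ∫⁻ x, ENNReal.ofReal
        (Real.exp (-l * (Real.exp (-α * (f x - f xs)) / (p₀ x * Z))) * p₀ x) :=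
        lintegral_congr fun x => (ENNReal.ofReal_mul (by positivity)).symm
    _ ≤ _ := lintegral_mono fun x => ENNReal.ofReal_le_ofReal (hle x)
    _ = _ := (ofReal_integral_eq_lintegral_ofReal iG (ae_of_all _ fun x =>
        (mul_nonneg (by positivity) (hp.nonneg x)).trans (hle x))).symm
    _ ≤ _ := by
        refine ENNReal.ofReal_le_ofReal ?_
        have e0 : ∫ x, (p₀ x - l / Z * Real.exp (-α * (f x - f xs)) +
            l ^ 2 / 2 * (Z ^ 2)⁻¹ * (Real.exp (-(2 * α) * (f x - f xs)) • (1 / g₀ x))) =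
            1 - l + l ^ 2 / 2 * secondMoment f xs α fun x => 1 / g₀ x := by
          have i12 : Integrable fun x => p₀ x - l / Z * Real.exp (-α * (f x - f xs)) := i1.sub i2
          refine (integral_add i12 i3).trans ?_
          rw [integral_sub i1 i2, integral_const_mul, integral_const_mul, hp.integral_eq_one]
          congr 1
          · congr 1
            change l / Z * normConst f xs α = l
            rw [← hZdef]; field_simp
          · rw [secondMoment, laplaceInt, ← hZdef, mul_assoc, inv_mul_eq_div]; rfl
        refine le_trans (le_of_eq e0) ?_
        have := Real.add_one_le_exp (-l + l ^ 2 / 2 * secondMoment f xs α fun x => 1 / g₀ x)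
        linarith

end Density

/-- The normalised importance weight `exp(-α (f(x) - f(x⋆))) / (q_i(x) Z_α)` at a point `x`. -/
noncomputable def nweight {d : ℕ} {Ω : Type*} (f : E d → ℝ) (xs : E d) (α : ℝ)
    (p : ℕ → Ω → E d → ℝ) (i : ℕ) (ω : Ω) (x : E d) : ℝ :=
  Real.exp (-α * (f x - f xs)) / (p i ω x * normConst f xs α)

section Sampling

variable {d q : ℕ} {Ω : Type*} {mΩ : MeasurableSpace Ω} {P : Measure Ω}
  {F : Filtration ℕ mΩ} {𝒬 : Set (E d → ℝ)} {X : ℕ → Ω → E d} {p : ℕ → Ω → E d → ℝ}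
  {f : E d → ℝ} {xs : E d} {φ : E d → E q} {g₀ : E d → ℝ} {M : ℝ}

theorem AdaptiveSampling.measurable_nweight (h : AdaptiveSampling P F 𝒬 X p)
    (hQ : ∀ p₀ ∈ 𝒬, IsDensity p₀) (hf : Continuous f) (α : ℝ) (i : ℕ) :
    Measurable[(past F i).prod inferInstance] (Function.uncurry (nweight f xs α p i)) := by
  let _ : MeasurableSpace Ω := past F i
  have h1 : Measurable (Function.uncurry (p i)) := h.measurable_past hQ i
  have hfm := hf.measurable
  have h2 : Measurable fun z : Ω × E d => Real.exp (-α * (f z.2 - f xs)) := by fun_prop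
  exact h2.div (h1.mul_const _)

theorem AdaptiveSampling.measurable_past_next (h : AdaptiveSampling P F 𝒬 X p) {i k : ℕ}
    (hik : i < k) : Measurable[past F k] (X (i + 1)) := by
  have : past F k = F k := if_neg (by omega)
  rw [this]
  exact (h.adapted i).mono (F.mono hik) le_rfl

theorem AdaptiveSampling.measurable_nweight_next (h : AdaptiveSampling P F 𝒬 X p)
    (hQ : ∀ p₀ ∈ 𝒬, IsDensity p₀) (hf : Continuous f) (α : ℝ) {i k : ℕ} (hik : i < k) :
    Measurable[past F k] fun ω => nweight f xs α p i ω (X (i + 1) ω) := by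
  have h1 := h.measurable_nweight hQ hf (xs := xs) α i
  have h2 : @Measurable Ω (Ω × E d) (past F k) ((past F i).prod inferInstance)
      fun ω => (ω, X (i + 1) ω) :=
    @Measurable.prodMk Ω (past F k) Ω (E d) (past F i) _ _ _
      (measurable_id'' (past_mono F hik.le)) (h.measurable_past_next hik)
  exact h1.comp h2

/-- The partial sums `∑_{i<k} w^i (φ(X^i) - φ(x⋆))`, centred for the last `n - k` terms. -/
noncomputable def centredSum (f : E d → ℝ) (xs : E d) (φ : E d → E q) (α : ℝ) (X : ℕ → Ω → E d)
    (p : ℕ → Ω → E d → ℝ) (n k : ℕ) (ω : Ω) : E q :=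
  ∑ i ∈ Finset.range k, nweight f xs α p i ω (X (i + 1) ω) • (φ (X (i + 1) ω) - φ xs) +
    ((n : ℝ) - k) • bias f xs φ α

theorem AdaptiveSampling.measurable_centredSum (h : AdaptiveSampling P F 𝒬 X p)
    (hQ : ∀ p₀ ∈ 𝒬, IsDensity p₀) (hf : Continuous f) (hφ : Continuous φ) (α : ℝ) (n k : ℕ) :
    Measurable[past F k] (centredSum f xs φ α X p n k) := by
  unfold centredSum
  refine Measurable.add_const (m := past F k) ?_ _
  refine Finset.measurable_fun_sum (m := past F k) _ fun i hi => ?_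
  have hik := Finset.mem_range.1 hi
  refine Measurable.smul (m := past F k) (h.measurable_nweight_next hQ hf α hik) ?_
  exact (hφ.measurable.sub_const _).comp (h.measurable_past_next hik)

theorem AdaptiveSampling.lintegral_centredSum_le [IsProbabilityMeasure P]
    (h : AdaptiveSampling P F 𝒬 X p) (hQ : PolicyFamily φ g₀ M 𝒬) (hf : Objective f xs)
    (hφ : TestFunction f xs φ) (hg : Envelope f xs φ g₀) {α : ℝ} (hα : 1 ≤ α) (n k : ℕ) :
    ∫⁻ ω, ENNReal.ofReal (‖centredSum f xs φ α X p n k ω‖ ^ 2) ∂P ≤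
      ENNReal.ofReal ((n : ℝ) ^ 2 * ‖bias f xs φ α‖ ^ 2 +
        k * secondMoment f xs α fun x => ‖φ x - φ xs‖ ^ 2 / g₀ x) := by
  set A := secondMoment f xs α fun x => ‖φ x - φ xs‖ ^ 2 / g₀ x with hA
  have hA0 : 0 ≤ A := div_nonneg (integral_nonneg fun x => by
    have := hg.pos x
    positivity) (by positivity)
  induction k with
  | zero => simp [centredSum, norm_smul, mul_pow]
  | succ k ih =>
    have hfc := hf.smooth.continuous
    have hφc := hφ.smooth.continuous
    let K : Ω → E d → ℝ≥0∞ := fun ω x => ENNReal.ofReal (‖centredSum f xs φ α X p n k ω +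
      (nweight f xs α p k ω x • (φ x - φ xs) - bias f xs φ α)‖ ^ 2)
    have hK : Measurable[(past F k).prod inferInstance] (Function.uncurry K) := by
      let _ : MeasurableSpace Ω := past F k
      have h1 : Measurable (centredSum f xs φ α X p n k) :=
        h.measurable_centredSum hQ.density hfc hφc α n k
      have h2 : Measurable (Function.uncurry (nweight f xs α p k)) :=
        h.measurable_nweight hQ.density hfc α k
      have h3 : Measurable fun z : Ω × E d => φ z.2 - φ xs :=
        (hφc.measurable.comp measurable_snd).sub_const _
      exact (((h1.comp measurable_fst).add ((h2.smul h3).sub_const _)).norm.pow_const 2).ennreal_ofReal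
    have hstep : ∀ ω, centredSum f xs φ α X p n (k + 1) ω = centredSum f xs φ α X p n k ω +
        (nweight f xs α p k ω (X (k + 1) ω) • (φ (X (k + 1) ω) - φ xs) - bias f xs φ α) := by
      intro ω
      simp only [centredSum, Finset.sum_range_succ]
      push_cast
      module
    calc ∫⁻ ω, ENNReal.ofReal (‖centredSum f xs φ α X p n (k + 1) ω‖ ^ 2) ∂P
        = ∫⁻ ω, K ω (X (k + 1) ω) ∂P := lintegral_congr fun ω => by rw [hstep]
      _ = ∫⁻ ω, (∫⁻ x, K ω x * ENNReal.ofReal (p k ω x)) ∂P := h.lintegral_next hQ.density k hK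
      _ ≤ ∫⁻ ω, (ENNReal.ofReal (‖centredSum f xs φ α X p n k ω‖ ^ 2) + ENNReal.ofReal A) ∂P := by
          refine lintegral_mono_ae ?_
          filter_upwards [h.ae_mem] with ω hω
          rw [← ENNReal.ofReal_add (by positivity) hA0]
          exact lintegral_norm_add_sq_le hf hφ hg (hQ.density _ (hω k)) (hQ.lower _ (hω k)) hα _
      _ = ∫⁻ ω, ENNReal.ofReal (‖centredSum f xs φ α X p n k ω‖ ^ 2) ∂P + ENNReal.ofReal A := by
          rw [lintegral_add_right _ measurable_const]; simp
      _ ≤ _ := by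
          refine (add_le_add_left ih _).trans ?_
          rw [← ENNReal.ofReal_add (by positivity) hA0]
          refine ENNReal.ofReal_le_ofReal (le_of_eq ?_)
          push_cast; ring

theorem AdaptiveSampling.lintegral_exp_neg_sum_le [IsProbabilityMeasure P]
    (h : AdaptiveSampling P F 𝒬 X p) (hQ : PolicyFamily φ g₀ M 𝒬) (hf : Objective f xs)
    (hg : Envelope f xs φ g₀) {α : ℝ} (hα : 1 ≤ α) {l : ℝ} (hl : 0 ≤ l) (k : ℕ) :
    ∫⁻ ω, ENNReal.ofReal
        (Real.exp (-l * ∑ i ∈ Finset.range k, nweight f xs α p i ω (X (i + 1) ω))) ∂P ≤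
      ENNReal.ofReal
        (Real.exp (k * (-l + l ^ 2 / 2 * secondMoment f xs α fun x => 1 / g₀ x))) := by
  set B := -l + l ^ 2 / 2 * secondMoment f xs α fun x => 1 / g₀ x with hB
  induction k with
  | zero => simp
  | succ k ih =>
    have hfc := hf.smooth.continuous
    let U : Ω → ℝ := fun ω => ∑ i ∈ Finset.range k, nweight f xs α p i ω (X (i + 1) ω)
    have hU : Measurable[past F k] U :=
      Finset.measurable_fun_sum (m := past F k) _ fun i hi =>
        h.measurable_nweight_next hQ.density hfc α (Finset.mem_range.1 hi)
    let K : Ω → E d → ℝ≥0∞ := fun ω x =>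
      ENNReal.ofReal (Real.exp (-l * U ω)) * ENNReal.ofReal (Real.exp (-l * nweight f xs α p k ω x))
    have hK : Measurable[(past F k).prod inferInstance] (Function.uncurry K) := by
      let _ : MeasurableSpace Ω := past F k
      have h2 : Measurable (Function.uncurry (nweight f xs α p k)) :=
        h.measurable_nweight hQ.density hfc α k
      exact (((hU.comp measurable_fst).const_mul (-l)).exp.ennreal_ofReal).mul
        (h2.const_mul (-l)).exp.ennreal_ofReal
    calc ∫⁻ ω, ENNReal.ofReal (Real.exp (-l *
          ∑ i ∈ Finset.range (k + 1), nweight f xs α p i ω (X (i + 1) ω))) ∂P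
        = ∫⁻ ω, K ω (X (k + 1) ω) ∂P := lintegral_congr fun ω => by
          rw [Finset.sum_range_succ, mul_add, Real.exp_add, ENNReal.ofReal_mul (by positivity)]
      _ = ∫⁻ ω, (∫⁻ x, K ω x * ENNReal.ofReal (p k ω x)) ∂P := h.lintegral_next hQ.density k hK
      _ ≤ ∫⁻ ω, ENNReal.ofReal (Real.exp (-l * U ω)) * ENNReal.ofReal (Real.exp B) ∂P := by
          refine lintegral_mono_ae ?_
          filter_upwards [h.ae_mem] with ω hω
          simp only [K, mul_assoc]
          rw [lintegral_const_mul' _ _ ENNReal.ofReal_ne_top]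
          gcongr
          exact lintegral_exp_neg_le hf hg (hQ.density _ (hω k)) (hQ.lower _ (hω k)) hα hl
      _ = (∫⁻ ω, ENNReal.ofReal (Real.exp (-l * U ω)) ∂P) * ENNReal.ofReal (Real.exp B) := by
          rw [lintegral_mul_const' _ _ ENNReal.ofReal_ne_top]
      _ ≤ _ := by
          refine (mul_le_mul_left ih _).trans ?_
          rw [← ENNReal.ofReal_mul (by positivity), ← Real.exp_add]
          refine ENNReal.ofReal_le_ofReal (le_of_eq ?_)
          push_cast; ring_nf

theorem AdaptiveSampling.lintegral_fourth_moment_le [IsProbabilityMeasure P]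
    (h : AdaptiveSampling P F 𝒬 X p) (hQ : PolicyFamily φ g₀ M 𝒬) (hφ : Continuous φ) (i : ℕ) :
    ∫⁻ ω, ENNReal.ofReal (‖φ (X (i + 1) ω) - φ xs‖ ^ 4) ∂P ≤
      ENNReal.ofReal (8 * (M + ‖φ xs‖ ^ 4)) := by
  let K : Ω → E d → ℝ≥0∞ := fun _ x => ENNReal.ofReal (‖φ x - φ xs‖ ^ 4)
  have hK : Measurable[(past F i).prod inferInstance] (Function.uncurry K) := by
    let _ : MeasurableSpace Ω := past F i
    exact ((((hφ.measurable.comp measurable_snd).sub_const _).norm.pow_const 4)).ennreal_ofReal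
  have hpt : ∀ x, ‖φ x - φ xs‖ ^ 4 ≤ 8 * (‖φ x‖ ^ 4 + ‖φ xs‖ ^ 4) := by
    intro x
    have h1 : ‖φ x - φ xs‖ ^ 4 ≤ (‖φ x‖ + ‖φ xs‖) ^ 4 := by gcongr; exact norm_sub_le _ _
    have h2 := add_pow_le (norm_nonneg (φ x)) (norm_nonneg (φ xs)) 4
    norm_num at h2
    linarith
  calc _ = ∫⁻ ω, (∫⁻ x, K ω x * ENNReal.ofReal (p i ω x)) ∂P := h.lintegral_next hQ.density i hK
    _ ≤ ∫⁻ _, ENNReal.ofReal (8 * (M + ‖φ xs‖ ^ 4)) ∂P := by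
        refine lintegral_mono_ae ?_
        filter_upwards [h.ae_mem] with ω hω
        have hp := hQ.density _ (hω i)
        have i1 := hQ.moment_integrable _ (hω i)
        have i2 := hp.integrable.const_mul (‖φ xs‖ ^ 4)
        calc ∫⁻ x, K ω x * ENNReal.ofReal (p i ω x)
            ≤ ∫⁻ x, ENNReal.ofReal (8 * (‖φ x‖ ^ 4 * p i ω x + ‖φ xs‖ ^ 4 * p i ω x)) := by
              refine lintegral_mono fun x => ?_
              rw [← ENNReal.ofReal_mul (by positivity)]
              refine ENNReal.ofReal_le_ofReal ?_
              have := mul_le_mul_of_nonneg_right (hpt x) (hp.nonneg x)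
              linarith
          _ = ENNReal.ofReal (∫ x, 8 * (‖φ x‖ ^ 4 * p i ω x + ‖φ xs‖ ^ 4 * p i ω x)) :=
              (ofReal_integral_eq_lintegral_ofReal ((i1.fun_add i2).const_mul 8)
                (ae_of_all _ fun x => by
                  have := hp.nonneg x
                  simp only [Pi.zero_apply]
                  positivity)).symm
          _ ≤ _ := by
              refine ENNReal.ofReal_le_ofReal ?_
              rw [integral_const_mul, integral_add i1 i2, integral_const_mul, hp.integral_eq_one,
                mul_one]
              have := hQ.moment_le _ (hω i)
              linarith
    _ = _ := by simp

theorem AdaptiveSampling.measurable_estimator (h : AdaptiveSampling P F 𝒬 X p)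
    (hQ : ∀ p₀ ∈ 𝒬, IsDensity p₀) (hf : Continuous f) (hφ : Continuous φ) (α : ℝ) (n : ℕ) :
    Measurable (estimator f φ α X p n) := by
  have hw : ∀ i, Measurable (weight f α X p i) := by
    intro i
    have hX := h.measurable_next i
    have h1 : Measurable fun ω => p i ω (X (i + 1) ω) := by
      have h2 : @Measurable Ω (Ω × E d) mΩ ((past F i).prod inferInstance)
          fun ω => (ω, X (i + 1) ω) :=
        @Measurable.prodMk Ω mΩ Ω (E d) (past F i) _ _ _ (measurable_id'' (past_le F i)) hX
      exact (h.measurable_past hQ i).comp h2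
    have hfm := hf.measurable
    exact Measurable.div (by fun_prop) h1
  refine Measurable.smul (Finset.measurable_fun_sum _ fun i _ => hw i).inv ?_
  exact Finset.measurable_fun_sum _ fun i _ =>
    (hw i).smul (hφ.measurable.comp (h.measurable_next i))

theorem estimator_sub_eq (hf : Objective f xs) {α : ℝ} (hα : 1 ≤ α) {n : ℕ} {ω : Ω}
    (hU : 0 < ∑ i ∈ Finset.range n, nweight f xs α p i ω (X (i + 1) ω)) :
    estimator f φ α X p n ω - φ xs =
      (∑ i ∈ Finset.range n, nweight f xs α p i ω (X (i + 1) ω))⁻¹ •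
        ∑ i ∈ Finset.range n, nweight f xs α p i ω (X (i + 1) ω) • (φ (X (i + 1) ω) - φ xs) := by
  have hZ := hf.normConst_pos hα
  set c := Real.exp (-α * f xs) * normConst f xs α with hc
  have hc0 : c ≠ 0 := by positivity
  have hw : ∀ i, weight f α X p i ω = c * nweight f xs α p i ω (X (i + 1) ω) := by
    intro i
    rw [weight, nweight, hc, show -α * f (X (i + 1) ω) =
      -α * f xs + -α * (f (X (i + 1) ω) - f xs) by ring, Real.exp_add, ← mul_div_assoc,
      mul_comm (p i ω _), mul_right_comm, mul_comm _ (normConst f xs α),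
      mul_div_mul_left _ _ hZ.ne']
  simp only [estimator, hw, mul_smul, ← Finset.smul_sum, ← Finset.mul_sum, smul_sub,
    Finset.sum_sub_distrib, ← Finset.sum_smul]
  rw [mul_inv, mul_smul, smul_comm, inv_smul_smul₀ hc0, inv_smul_smul₀ hU.ne']

theorem sq_norm_weighted_mean_le {ι : Type*} {s : Finset ι} (hs : s.Nonempty) {w : ι → ℝ}
    (hw : ∀ i ∈ s, 0 < w i) {y : ι → E q} {N l τ : ℝ} (hN : 0 < N) (hl : 0 ≤ l) (hτ : 0 < τ) :
    ‖(∑ i ∈ s, w i)⁻¹ • ∑ i ∈ s, w i • y i‖ ^ 2 ≤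
      9 / (4 * N ^ 2) * ‖∑ i ∈ s, w i • y i‖ ^ 2 +
        τ / 2 * Real.exp (l * (2 / 3 * N)) * Real.exp (-l * ∑ i ∈ s, w i) +
        1 / (2 * τ) * ∑ i ∈ s, ‖y i‖ ^ 4 := by
  set U := ∑ i ∈ s, w i with hUdef
  set T := ∑ i ∈ s, w i • y i with hT
  have hU : 0 < U := Finset.sum_pos hw hs
  have hS : 0 ≤ ∑ i ∈ s, ‖y i‖ ^ 4 := Finset.sum_nonneg fun i _ => by positivity
  have hn : ‖U⁻¹ • T‖ = U⁻¹ * ‖T‖ := by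
    rw [norm_smul, Real.norm_of_nonneg (by positivity)]
  rcases le_or_gt (2 / 3 * N) U with hc | hc
  · have h1 : ‖U⁻¹ • T‖ ^ 2 ≤ 9 / (4 * N ^ 2) * ‖T‖ ^ 2 := by
      rw [hn, mul_pow]
      gcongr
      calc (U⁻¹) ^ 2 ≤ ((2 / 3 * N)⁻¹) ^ 2 := by gcongr
        _ = 9 / (4 * N ^ 2) := by field_simp; norm_num
    have h2 : 0 ≤ τ / 2 * Real.exp (l * (2 / 3 * N)) * Real.exp (-l * U) := by positivity
    have h3 : 0 ≤ 1 / (2 * τ) * ∑ i ∈ s, ‖y i‖ ^ 4 :=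
      mul_nonneg (by positivity) hS
    linarith
  · obtain ⟨j, hj, hmax⟩ := s.exists_max_image (fun i => ‖y i‖) hs
    have h1 : ‖U⁻¹ • T‖ ≤ ‖y j‖ := by
      rw [hn, inv_mul_le_iff₀ hU, hUdef, Finset.sum_mul]
      refine (norm_sum_le _ _).trans (Finset.sum_le_sum fun i hi => ?_)
      rw [norm_smul, Real.norm_of_nonneg (hw i hi).le]
      have := (hw i hi).le
      have := hmax i hi
      gcongr
    have h2 : ‖U⁻¹ • T‖ ^ 2 ≤ ‖y j‖ ^ 2 := by gcongr
    have h3 : ‖y j‖ ^ 4 ≤ ∑ i ∈ s, ‖y i‖ ^ 4 :=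
      Finset.single_le_sum (f := fun i => ‖y i‖ ^ 4) (fun i _ => by positivity) hj
    have h4 : ‖y j‖ ^ 2 ≤ τ / 2 + 1 / (2 * τ) * ‖y j‖ ^ 4 := by
      have : τ / 2 + 1 / (2 * τ) * ‖y j‖ ^ 4 - ‖y j‖ ^ 2 = (τ - ‖y j‖ ^ 2) ^ 2 / (2 * τ) := by
        field_simp; ring
      have h5 : 0 ≤ (τ - ‖y j‖ ^ 2) ^ 2 / (2 * τ) := by positivity
      linarith
    have h5 : 1 / (2 * τ) * ‖y j‖ ^ 4 ≤ 1 / (2 * τ) * ∑ i ∈ s, ‖y i‖ ^ 4 := by gcongr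
    have h6 : (1 : ℝ) ≤ Real.exp (l * (2 / 3 * N)) * Real.exp (-l * U) := by
      rw [← Real.exp_add]
      refine Real.one_le_exp ?_
      nlinarith
    have h7 : τ / 2 ≤ τ / 2 * Real.exp (l * (2 / 3 * N)) * Real.exp (-l * U) := by
      rw [mul_assoc]
      exact le_mul_of_one_le_right (by positivity) h6
    have h8 : 0 ≤ 9 / (4 * N ^ 2) * ‖T‖ ^ 2 := by positivity
    linarith

theorem AdaptiveSampling.mse_le [IsProbabilityMeasure P]
    (h : AdaptiveSampling P F 𝒬 X p) (hQ : PolicyFamily φ g₀ M 𝒬) (hf : Objective f xs)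
    (hφ : TestFunction f xs φ) (hg : Envelope f xs φ g₀) {α : ℝ} (hα : 1 ≤ α) {n : ℕ}
    (hn : 1 ≤ n) {v τ : ℝ} (hv : 0 < v) (hv' : (secondMoment f xs α fun x => 1 / g₀ x) ≤ v)
    (hτ : 0 < τ) :
    Integrable (fun ω => ‖estimator f φ α X p n ω - φ xs‖ ^ 2) P ∧
    ∫ ω, ‖estimator f φ α X p n ω - φ xs‖ ^ 2 ∂P ≤
      9 / 4 * ‖bias f xs φ α‖ ^ 2 +
        9 / 4 * (n : ℝ)⁻¹ * (secondMoment f xs α fun x => ‖φ x - φ xs‖ ^ 2 / g₀ x) +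
        τ / 2 * Real.exp (-n / (18 * v)) + n * (8 * (M + ‖φ xs‖ ^ 4)) / (2 * τ) := by
  have hfc := hf.smooth.continuous
  have hφc := hφ.smooth.continuous
  have hZ := hf.normConst_pos hα
  have hN : (0 : ℝ) < n := by exact_mod_cast hn
  set l := 1 / (3 * v) with hl
  have hl0 : 0 ≤ l := by positivity
  set A := secondMoment f xs α fun x => ‖φ x - φ xs‖ ^ 2 / g₀ x with hA
  have hA0 : 0 ≤ A := div_nonneg (integral_nonneg fun x => by
    have := hg.pos x
    positivity) (by positivity)
  obtain ⟨q₀, hq₀, -, -⟩ := h.init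
  have hM : 0 ≤ M := le_trans (integral_nonneg fun y =>
    mul_nonneg (by positivity) ((hQ.density q₀ hq₀).nonneg y)) (hQ.moment_le q₀ hq₀)
  set R : Ω → ℝ := fun ω => ‖estimator f φ α X p n ω - φ xs‖ ^ 2 with hR
  have hRm : Measurable R :=
    ((h.measurable_estimator hQ.density hfc hφc α n).sub_const _).norm.pow_const 2
  have hpt : ∀ᵐ ω ∂P, ENNReal.ofReal (R ω) ≤
      ENNReal.ofReal (9 / (4 * (n : ℝ) ^ 2)) *
        ENNReal.ofReal (‖centredSum f xs φ α X p n n ω‖ ^ 2) +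
      ENNReal.ofReal (τ / 2 * Real.exp (l * (2 / 3 * n))) * ENNReal.ofReal (Real.exp (-l *
        ∑ i ∈ Finset.range n, nweight f xs α p i ω (X (i + 1) ω))) +
      ENNReal.ofReal (1 / (2 * τ)) *
        ∑ i ∈ Finset.range n, ENNReal.ofReal (‖φ (X (i + 1) ω) - φ xs‖ ^ 4) := by
    filter_upwards [h.ae_mem] with ω hω
    have hs : (Finset.range n).Nonempty := Finset.nonempty_range_iff.2 (by omega)
    have hw : ∀ i ∈ Finset.range n, 0 < nweight f xs α p i ω (X (i + 1) ω) := fun i _ => by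
      have := (hg.pos (X (i + 1) ω)).trans_le (hQ.lower _ (hω i) _)
      unfold nweight
      positivity
    have h1 := sq_norm_weighted_mean_le hs hw (y := fun i => φ (X (i + 1) ω) - φ xs) hN hl0 hτ
    rw [← estimator_sub_eq hf hα (Finset.sum_pos hw hs)] at h1
    have h2 : centredSum f xs φ α X p n n ω = ∑ i ∈ Finset.range n,
        nweight f xs α p i ω (X (i + 1) ω) • (φ (X (i + 1) ω) - φ xs) := by
      simp [centredSum]
    rw [← h2] at h1
    rw [← ENNReal.ofReal_sum_of_nonneg (fun i _ => by positivity),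
      ← ENNReal.ofReal_mul (by positivity), ← ENNReal.ofReal_mul (by positivity),
      ← ENNReal.ofReal_mul (by positivity), ← ENNReal.ofReal_add (by positivity) (by positivity),
      ← ENNReal.ofReal_add (by positivity) (by positivity)]
    exact ENNReal.ofReal_le_ofReal h1
  have hcm : Measurable (centredSum f xs φ α X p n n) :=
    (h.measurable_centredSum hQ.density hfc hφc α n n).mono (past_le F n) le_rfl
  have hUm : Measurable fun ω => ∑ i ∈ Finset.range n, nweight f xs α p i ω (X (i + 1) ω) :=
    Finset.measurable_fun_sum _ fun i hi =>
      (h.measurable_nweight_next hQ.density hfc α (Finset.mem_range.1 hi)).mono (past_le F n) le_rfl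
  have hφm : ∀ i, Measurable fun ω => ENNReal.ofReal (‖φ (X (i + 1) ω) - φ xs‖ ^ 4) := fun i =>
    (((hφc.measurable.comp (h.measurable_next i)).sub_const _).norm.pow_const 4).ennreal_ofReal
  have hbound : ∫⁻ ω, ENNReal.ofReal (R ω) ∂P ≤ ENNReal.ofReal
      (9 / 4 * ‖bias f xs φ α‖ ^ 2 + 9 / 4 * (n : ℝ)⁻¹ * A +
        τ / 2 * Real.exp (-n / (18 * v)) + n * (8 * (M + ‖φ xs‖ ^ 4)) / (2 * τ)) := by
    refine (lintegral_mono_ae hpt).trans ?_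
    rw [lintegral_add_right _ (by
        exact (Finset.measurable_fun_sum _ fun i _ => hφm i).const_mul _),
      lintegral_add_left ((hcm.norm.pow_const 2).ennreal_ofReal.const_mul _),
      lintegral_const_mul' _ _ ENNReal.ofReal_ne_top,
      lintegral_const_mul' _ _ ENNReal.ofReal_ne_top,
      lintegral_const_mul' _ _ ENNReal.ofReal_ne_top,
      lintegral_finsetSum _ fun i _ => hφm i]
    have b1 := h.lintegral_centredSum_le hQ hf hφ hg hα n n
    have b2 := h.lintegral_exp_neg_sum_le hQ hf hg hα hl0 n
    have b3 : ∑ i ∈ Finset.range n, ∫⁻ ω, ENNReal.ofReal (‖φ (X (i + 1) ω) - φ xs‖ ^ 4) ∂P ≤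
        ENNReal.ofReal (n * (8 * (M + ‖φ xs‖ ^ 4))) := by
      refine (Finset.sum_le_sum fun i _ => h.lintegral_fourth_moment_le hQ hφc i).trans ?_
      rw [Finset.sum_const, Finset.card_range, nsmul_eq_mul, ENNReal.ofReal_mul hN.le,
        ENNReal.ofReal_natCast]
    refine (add_le_add (add_le_add (mul_le_mul_right b1 _) (mul_le_mul_right b2 _))
      (mul_le_mul_right b3 _)).trans ?_
    rw [← ENNReal.ofReal_mul (by positivity), ← ENNReal.ofReal_mul (by positivity),
      ← ENNReal.ofReal_mul (by positivity), ← ENNReal.ofReal_add (by positivity) (by positivity),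
      ← ENNReal.ofReal_add (by positivity) (by positivity)]
    refine ENNReal.ofReal_le_ofReal ?_
    have e1 : 9 / (4 * (n : ℝ) ^ 2) * ((n : ℝ) ^ 2 * ‖bias f xs φ α‖ ^ 2 + n * A) =
        9 / 4 * ‖bias f xs φ α‖ ^ 2 + 9 / 4 * (n : ℝ)⁻¹ * A := by field_simp
    have e2 : Real.exp (l * (2 / 3 * n)) * Real.exp (n * (-l + l ^ 2 / 2 *
        secondMoment f xs α fun x => 1 / g₀ x)) ≤ Real.exp (-n / (18 * v)) := by
      rw [← Real.exp_add, Real.exp_le_exp]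
      have : (n : ℝ) * (l ^ 2 / 2 * secondMoment f xs α fun x => 1 / g₀ x) ≤
          n * (l ^ 2 / 2 * v) := by gcongr
      have e3 : l * (2 / 3 * n) + (n * -l + n * (l ^ 2 / 2 * v)) = -n / (18 * v) := by
        rw [hl]; field_simp; ring
      rw [← e3, mul_add]
      linarith
    have e4 : τ / 2 * Real.exp (l * (2 / 3 * n)) * Real.exp (n * (-l + l ^ 2 / 2 *
        secondMoment f xs α fun x => 1 / g₀ x)) ≤ τ / 2 * Real.exp (-n / (18 * v)) := by
      rw [mul_assoc]; gcongr
    have e5 : 1 / (2 * τ) * (n * (8 * (M + ‖φ xs‖ ^ 4))) =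
        n * (8 * (M + ‖φ xs‖ ^ 4)) / (2 * τ) := by ring
    rw [e1, e5]
    linarith
  have hR0 : 0 ≤ᵐ[P] R := ae_of_all _ fun ω => by simp only [hR, Pi.zero_apply]; positivity
  refine ⟨⟨hRm.aestronglyMeasurable, ?_⟩, ?_⟩
  · rw [hasFiniteIntegral_iff_ofReal hR0]
    exact hbound.trans_lt ENNReal.ofReal_lt_top
  · rw [integral_eq_lintegral_of_nonneg_ae hR0 hRm.aestronglyMeasurable]
    exact ENNReal.toReal_le_of_le_ofReal (by positivity) hbound

end Sampling

/-- The sample-size condition makes the contribution of small total weights negligible. -/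
theorem sqrt_mul_exp_le_of_log_le {d : ℕ} {α K N : ℝ} (hα : 0 < α) (hK : 0 < K) (hN : 0 < N)
    (h : N ≥ 36 * K * α ^ ((d : ℝ) / 2) * Real.log (N * α ^ (-(d : ℝ) / 2 + 1) *
      (Real.sqrt N + α ^ ((d : ℝ) / 4)) * α)) :
    Real.sqrt N * Real.exp (-N / (36 * (K * α ^ ((d : ℝ) / 2)))) ≤
      N⁻¹ * (α ^ ((d : ℝ) / 2) / α ^ 2) := by
  set a := α ^ ((d : ℝ) / 2) with ha
  have ha0 : 0 < a := Real.rpow_pos_of_pos hα _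
  have hb0 : 0 < α ^ ((d : ℝ) / 4) := Real.rpow_pos_of_pos hα _
  have hs : 0 < Real.sqrt N := Real.sqrt_pos.2 hN
  have he : α ^ (-(d : ℝ) / 2 + 1) = α / a := by
    rw [neg_div, Real.rpow_add hα, Real.rpow_neg hα.le, Real.rpow_one, ← ha]
    field_simp
  rw [he] at h
  have hL : 0 < N * (α / a) * (Real.sqrt N + α ^ ((d : ℝ) / 4)) * α := by positivity
  have h1 : Real.log (N * (α / a) * (Real.sqrt N + α ^ ((d : ℝ) / 4)) * α) ≤
      N / (36 * (K * a)) := by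
    rw [le_div_iff₀ (by positivity)]
    linarith
  rw [Real.log_le_iff_le_exp hL] at h1
  have h2 : N * (α / a) * Real.sqrt N * α ≤ Real.exp (N / (36 * (K * a))) := by
    refine le_trans ?_ h1
    gcongr
    linarith
  rw [neg_div, Real.exp_neg, ← div_eq_mul_inv, div_le_iff₀ (Real.exp_pos _)]
  calc Real.sqrt N = N⁻¹ * (a / α ^ 2) * (N * (α / a) * Real.sqrt N * α) := by field_simp
    _ ≤ _ := by gcongr

end LISO

theorem stmt16 {d q : ℕ} (f : LISO.E d → ℝ) (xs : LISO.E d) (hf : LISO.Objective f xs)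
    (φ : LISO.E d → LISO.E q) (hφ : LISO.TestFunction f xs φ) :
    ∃ αt > (1 : ℝ), ∀ g₀ : LISO.E d → ℝ, LISO.Envelope f xs φ g₀ →
      ∃ c > (0 : ℝ), ∀ M : ℝ, ∃ C > (0 : ℝ),
        ∀ α > αt, ∀ n : ℕ, 1 ≤ n →
          (n : ℝ) ≥ c * α ^ ((d : ℝ) / 2) *
            Real.log ((n : ℝ) * α ^ (-(d : ℝ) / 2 + 1) *
              (Real.sqrt (n : ℝ) + α ^ ((d : ℝ) / 4)) * α) →
          ∀ 𝒬 : Set (LISO.E d → ℝ), LISO.PolicyFamily φ g₀ M 𝒬 →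
          ∀ (Ω : Type*) (mΩ : MeasurableSpace Ω) (P : Measure Ω) (_ : IsProbabilityMeasure P)
            (F : Filtration ℕ mΩ) (X : ℕ → Ω → LISO.E d) (p : ℕ → Ω → LISO.E d → ℝ),
            LISO.AdaptiveSampling P F 𝒬 X p →
            Integrable (fun ω => ‖LISO.estimator f φ α X p n ω - φ xs‖ ^ 2) P ∧
            ∫ ω, ‖LISO.estimator f φ α X p n ω - φ xs‖ ^ 2 ∂P ≤
              9 * (n : ℝ)⁻¹ * LISO.mconst f xs α * (2 : ℝ) ^ (-(d : ℝ) / 2) *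
                (LISO.CLs f xs (fun x => ‖φ x - φ xs‖ ^ 2 / g₀ x) / (2 * α)) * (1 + C / α) +
              LISO.CL f xs φ ^ 2 / α ^ 2 := by
  obtain ⟨αt, hαt, hbias⟩ := hφ.exists_bias_bound hf
  refine ⟨αt, hαt, fun g₀ hg => ?_⟩
  obtain ⟨K, hK, hv⟩ := LISO.exists_secondMoment_le hf hg.smooth_inv.continuous
    (fun x => by have := hg.pos x; positivity) (hg.integrable_inv hf)
  obtain ⟨C₁, hC₁, hA⟩ := LISO.exists_secondMoment_le_of_eq_zero hf hg.smooth_bar_sq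
    (fun x => by have := hg.pos x; positivity) (by simp) hg.coeff_bar_sq_pos
    (hg.integrable_bar_sq hf)
  refine ⟨36 * K, by positivity, fun M => ?_⟩
  have hG := hf.gaussConst_pos
  have hCb := hg.coeff_bar_sq_pos
  set Cb := LISO.CLs f xs (fun x => ‖φ x - φ xs‖ ^ 2 / g₀ x) with hCbdef
  set t := (2 : ℝ) ^ (-(d : ℝ) / 2) with ht
  have ht0 : 0 < t := Real.rpow_pos_of_pos two_pos _
  set D := 9 * t * Cb / (2 * LISO.gaussConst f xs) with hD
  have hD0 : 0 < D := by positivity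
  set M' := 8 * (|M| + ‖φ xs‖ ^ 4) + 1 with hM'
  have hM'0 : 0 < M' := by positivity
  refine ⟨C₁ + Real.sqrt M' / D, by positivity, fun α hα n hn hlog 𝒬 hQ Ω mΩ P hP F X p h => ?_⟩
  have hα1 : 1 ≤ α := (hαt.trans hα).le
  have hα0 : 0 < α := by linarith
  have hN : (0 : ℝ) < n := by exact_mod_cast hn
  have ha0 : 0 < α ^ ((d : ℝ) / 2) := Real.rpow_pos_of_pos hα0 _
  set v := K * α ^ ((d : ℝ) / 2) with hvdef
  have hv0 : 0 < v := by positivity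
  set e := Real.exp (-n / (36 * v)) with he
  have he0 : 0 < e := Real.exp_pos _
  have hs0 : 0 < Real.sqrt n := Real.sqrt_pos.2 hN
  have hsM : 0 < Real.sqrt M' := Real.sqrt_pos.2 hM'0
  have key : Real.sqrt n * e ≤ (n : ℝ)⁻¹ * (α ^ ((d : ℝ) / 2) / α ^ 2) :=
    LISO.sqrt_mul_exp_le_of_log_le hα0 hK hN hlog
  obtain ⟨hint, hle⟩ := h.mse_le hQ hf hφ hg hα1 hn hv0 (hv α hα1)
    (τ := Real.sqrt n * Real.sqrt M' / e) (by positivity)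
  refine ⟨hint, hle.trans ?_⟩
  have h1 := hbias α hα
  have h2 := mul_le_mul_of_nonneg_left (hA α hα1) (inv_nonneg.2 hN.le)
  have e2 : Real.exp (-n / (18 * v)) = e ^ 2 := by
    rw [he, ← Real.exp_nat_mul]
    congr 1
    push_cast
    field_simp
    norm_num
  have h3 : Real.sqrt n * Real.sqrt M' / e / 2 * Real.exp (-n / (18 * v)) =
      Real.sqrt M' * (Real.sqrt n * e) / 2 := by
    rw [e2]; field_simp
  have h4 : n * (8 * (M + ‖φ xs‖ ^ 4)) / (2 * (Real.sqrt n * Real.sqrt M' / e)) ≤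
      Real.sqrt M' * (Real.sqrt n * e) / 2 := by
    calc n * (8 * (M + ‖φ xs‖ ^ 4)) / (2 * (Real.sqrt n * Real.sqrt M' / e))
        ≤ n * M' / (2 * (Real.sqrt n * Real.sqrt M' / e)) := by
          gcongr
          rw [hM']
          linarith [le_abs_self M]
      _ = (Real.sqrt n * Real.sqrt n) * (Real.sqrt M' * Real.sqrt M') /
            (2 * (Real.sqrt n * Real.sqrt M' / e)) := by
          rw [Real.mul_self_sqrt hN.le, Real.mul_self_sqrt hM'0.le]
      _ = _ := by field_simp
  have h5 : Real.sqrt M' * (Real.sqrt n * e) ≤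
      Real.sqrt M' * ((n : ℝ)⁻¹ * (α ^ ((d : ℝ) / 2) / α ^ 2)) := by gcongr
  have h6 : 9 * (n : ℝ)⁻¹ * LISO.mconst f xs α * t * (Cb / (2 * α)) *
      (Real.sqrt M' / D / α) = Real.sqrt M' * ((n : ℝ)⁻¹ * (α ^ ((d : ℝ) / 2) / α ^ 2)) := by
    rw [hf.mconst_eq hα0.le, hD]; field_simp
  have h7 : 9 * (n : ℝ)⁻¹ * LISO.mconst f xs α * t * (Cb / (2 * α)) *
      (1 + (C₁ + Real.sqrt M' / D) / α) =
      (n : ℝ)⁻¹ * (9 * LISO.mconst f xs α * t * (Cb / (2 * α)) * (1 + C₁ / α)) +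
      9 * (n : ℝ)⁻¹ * LISO.mconst f xs α * t * (Cb / (2 * α)) * (Real.sqrt M' / D / α) := by
    ring
  rw [h7, h6, h3]
  linarith
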